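/- arXiv:0806.4572 — 2 statements merged into one kernel-verified Lean document; each statement's English description precedes it below -/
import Mathlib

section
/- Let P be a computable stationary ergodic probability measure on Ω with entropy H, let {φ_N} be the LZ78 code, and let ω be Martin-Löf random with respect to P. Then lim_{N→∞} limsup_{n→∞} ρ_{φ_N}(ω^n) = H, where ρ_{φ_N} is the compression ratio of the block realization with block length N. -/
open MeasureTheory Filter
open scoped ENNReal NNReal

/-- The cylinder `Γ_x` of all infinite binary sequences extending the word `x`. -/
def cyl (x : List Bool) : Set (ℕ → Bool) := {ω | ∀ i, i < x.length → ω i = x.getD i false}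

/-- `ω^n`, the length-`n` prefix of the infinite sequence `ω`. -/
def pre (ω : ℕ → Bool) (n : ℕ) : List Bool := List.ofFn (fun i : Fin n => ω i)

/-- The left shift on infinite binary sequences. -/
def shift (ω : ℕ → Bool) : ℕ → Bool := fun i => ω (i + 1)

/-- A measure on the set of infinite binary sequences is computable if some
algorithm, given a word `x` and a rational `ε > 0`, outputs a rational within
`ε` of `P(Γ_x)`. -/
def ComputableMeasure (μ : Measure (ℕ → Bool)) : Prop :=
  ∃ f : List Bool × ℚ → ℚ, Computable f ∧
    ∀ (x : List Bool) (ε : ℚ), 0 < ε → |(μ (cyl x)).toReal - (f (x, ε) : ℝ)| ≤ (ε : ℝ)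

/-- `(1/n) Σ_{l(x)=n} -P(x) log₂ P(x)`, the `n`-th entropy approximation. -/
noncomputable def entropyAt (μ : Measure (ℕ → Bool)) (n : ℕ) : ℝ :=
  (1 / n : ℝ) * ∑ v : Fin n → Bool,
    -((μ (cyl (List.ofFn v))).toReal * Real.logb 2 (μ (cyl (List.ofFn v))).toReal)

/-- `H` is the entropy of the (stationary) measure `μ`. -/
def HasEntropy (μ : Measure (ℕ → Bool)) (H : ℝ) : Prop :=
  Tendsto (fun n => entropyAt μ n) atTop (nhds H)

/-- `M` is an effectively `μ`-null set. -/
def EffNull (μ : Measure (ℕ → Bool)) (M : Set (ℕ → Bool)) : Prop :=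
  ∃ g : ℚ × ℕ → List Bool, Computable g ∧
    ∀ ε : ℚ, 0 < ε →
      M ⊆ (⋃ i, cyl (g (ε, i))) ∧ μ (⋃ i, cyl (g (ε, i))) < ENNReal.ofReal (ε : ℝ)

/-- `ω` is Martin-Löf random with respect to `μ`: it belongs to no
effectively `μ`-null set. -/
def MLRandom (μ : Measure (ℕ → Bool)) (ω : ℕ → Bool) : Prop :=
  ∀ M : Set (ℕ → Bool), EffNull μ M → ω ∉ M

/-- LZ78 parsing: number of phrases. The word is parsed into consecutive
phrases, each phrase being the shortest prefix of the unparsed remainder that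
differs from all previous phrases (the final phrase may repeat an earlier
one). The first argument is fuel (the word length always suffices). -/
def lzCountAux : ℕ → List Bool → List (List Bool) → ℕ
  | 0, _, _ => 0
  | fuel + 1, rest, seen =>
    if rest = [] then 0
    else
      let j := (((List.range rest.length).filter
        (fun jj => decide (rest.take (jj + 1) ∉ seen))).head?).getD (rest.length - 1)
      1 + lzCountAux fuel (rest.drop (j + 1)) (rest.take (j + 1) :: seen)

/-- The number of phrases `c` in the LZ78 parsing of `x`. -/
def lzCount (x : List Bool) : ℕ := lzCountAux x.length x []

/-- The LZ78 code length of `x`: the `k`-th phrase is encoded by the index of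
its longest proper prefix among earlier phrases together with its last letter,
using `⌈log₂ k⌉ + 1` bits, so `l(φ(x)) = Σ_{k=1}^{c} (⌈log₂ k⌉ + 1)`. -/
def lzLen (x : List Bool) : ℕ := ∑ k ∈ Finset.range (lzCount x), (Nat.clog 2 (k + 1) + 1)

/-- Total code length of the block realization with block length `N` of a code
whose length function on a block is `len`: the word `ω^n` is divided into
`n / N` full blocks of length `N` which are encoded separately, and the final
incomplete block is encoded verbatim (`n % N` bits). -/
def blockLenOf (len : List Bool → ℕ) (N : ℕ) (ω : ℕ → Bool) (n : ℕ) : ℕ :=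
  (∑ i ∈ Finset.range (n / N), len (List.ofFn (fun j : Fin N => ω (i * N + j)))) + n % N

/-- The compression ratio `ρ_{φ_N}(ω^n)` of the block realization. -/
noncomputable def blockRatioOf (len : List Bool → ℕ) (N : ℕ) (ω : ℕ → Bool) (n : ℕ) : ℝ≥0∞ :=
  (blockLenOf len N ω n : ℝ≥0∞) / n

section Computability

/-- Unbounded search for a computable total predicate is computable. -/
theorem Computable.exists_find {α : Type*} [Primcodable α] {p : α → ℕ → Bool}
    (hp : Computable₂ p) (h : ∀ a, ∃ n, p a n = true) :
    ∃ f : α → ℕ, Computable f ∧ ∀ a, p a (f a) = true ∧ ∀ m < f a, p a m = false := by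
  classical
  refine ⟨fun a => Nat.find (h a), ?_, fun a => ⟨Nat.find_spec (h a), fun m hm => ?_⟩⟩
  · refine Partrec.of_eq_tot (Partrec.rfind (p := fun a n => (p a n : Part Bool)) hp.partrec₂) ?_
    intro a
    refine Nat.mem_rfind.2 ⟨?_, fun {m} hm => ?_⟩
    · simpa using Nat.find_spec (h a)
    · have := Nat.find_min (h a) hm
      simpa using this
  · simpa using Nat.find_min (h a) hm

theorem Nat.Subtype.computable_ofNat (s : Set ℕ) [DecidablePred (· ∈ s)] [Infinite s]
    (hs : Computable fun n => decide (n ∈ s)) :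
    Computable fun n => (Nat.Subtype.ofNat s n : ℕ) := by
  have hex : ∀ x : ℕ, ∃ m, decide (x + m + 1 ∈ s) = true := by
    intro x
    obtain ⟨y, hy, hxy⟩ := Set.infinite_coe_iff.1 ‹Infinite s› |>.exists_gt x
    exact ⟨y - x - 1, by rw [decide_eq_true_eq]; convert hy using 1; omega⟩
  obtain ⟨f, hf, hfp⟩ := Computable.exists_find (p := fun x m => decide (x + m + 1 ∈ s))
    (hs.comp (Computable.succ.comp
      (Primrec.nat_add.to_comp.comp Computable.fst Computable.snd))).to₂ hex
  have hstep : Computable fun x => x + f x + 1 :=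
    Computable.succ.comp (Primrec.nat_add.to_comp.comp Computable.id hf)
  refine (Computable.nat_rec (f := fun n : ℕ => n) (g := fun _ => (Nat.Subtype.ofNat s 0 : ℕ))
    (h := fun _ q => q.2 + f q.2 + 1) Computable.id (Computable.const _)
    (hstep.comp (Computable.snd.comp Computable.snd)).to₂).of_eq ?_
  intro n
  induction n with
  | zero => rfl
  | succ n ih =>
    have : (Nat.Subtype.ofNat s (n + 1) : ℕ) =
        (Nat.Subtype.ofNat s n : ℕ) + f (Nat.Subtype.ofNat s n) + 1 := by
      have hf' : f (Nat.Subtype.ofNat s n) =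
          Nat.find (Nat.Subtype.exists_succ (Nat.Subtype.ofNat s n)) := by
        symm
        rw [Nat.find_eq_iff]
        exact ⟨by simpa using (hfp (Nat.Subtype.ofNat s n)).1,
          fun m hm => by simpa using (hfp (Nat.Subtype.ofNat s n)).2 m hm⟩
      rw [hf']
      rfl
    simp only at ih ⊢
    rw [this, ← ih]

/-- The natural number coding the reduced fraction of a rational number. -/
def ratCode (q : ℚ) : ℕ := Nat.pair (Encodable.encode q.num) q.den

theorem encode_int_two_mul (n : ℕ) : Encodable.encode (n : ℤ) = 2 * n := rfl

theorem encode_int_negSucc (n : ℕ) : Encodable.encode (Int.negSucc n) = 2 * n + 1 := rfl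

theorem natAbs_eq_encode (z : ℤ) : z.natAbs = (Encodable.encode z + 1) / 2 := by
  cases z with
  | ofNat n => rw [Int.ofNat_eq_natCast, encode_int_two_mul]; simp; omega
  | negSucc n => rw [encode_int_negSucc]; simp; omega

theorem ratCode_injective : Function.Injective ratCode := by
  intro p q h
  simp only [ratCode, Nat.pair_eq_pair, Encodable.encode_inj] at h
  exact Rat.ext h.1 h.2

theorem mem_range_ratCode (y : ℕ) : y ∈ Set.range ratCode ↔
    0 < y.unpair.2 ∧ ∀ x < y.unpair.2 + 1,
      ((y.unpair.1 + 1) / 2) % x = 0 ∧ y.unpair.2 % x = 0 → x = 1 := by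
  have key : y ∈ Set.range ratCode ↔
      0 < y.unpair.2 ∧ ((y.unpair.1 + 1) / 2).Coprime y.unpair.2 := by
    constructor
    · rintro ⟨q, rfl⟩
      simp only [ratCode, Nat.unpair_pair, ← natAbs_eq_encode]
      exact ⟨q.den_pos, q.reduced⟩
    · rintro ⟨h0, h1⟩
      set z : ℤ := Denumerable.ofNat ℤ y.unpair.1 with hz
      have hz' : Encodable.encode z = y.unpair.1 := Denumerable.encode_ofNat _
      rw [← hz', ← natAbs_eq_encode] at h1
      refine ⟨⟨z, y.unpair.2, h0.ne', h1⟩, ?_⟩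
      simp [ratCode, hz']
  rw [key]
  refine and_congr_right fun h0 => ⟨fun h x _ hx => ?_, fun h => ?_⟩
  · exact Nat.eq_one_of_dvd_coprimes h (Nat.dvd_of_mod_eq_zero hx.1) (Nat.dvd_of_mod_eq_zero hx.2)
  · refine h _ (Nat.lt_succ_of_le (Nat.gcd_le_right _ h0)) ⟨?_, ?_⟩
    · exact Nat.mod_eq_zero_of_dvd (Nat.gcd_dvd_left _ _)
    · exact Nat.mod_eq_zero_of_dvd (Nat.gcd_dvd_right _ _)

theorem primrecPred_mem_range_ratCode : PrimrecPred fun y => y ∈ Set.range ratCode := by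
  have hR : PrimrecRel fun (x : ℕ) (y : ℕ × ℕ) =>
      ¬ (((y.1 + 1) / 2) % x = 0 ∧ y.2 % x = 0) ∨ x = 1 := by
    have h1 : PrimrecRel fun (x : ℕ) (y : ℕ × ℕ) => ((y.1 + 1) / 2) % x = 0 :=
      Primrec.eq.comp (Primrec.nat_mod.comp (Primrec.nat_div.comp
        (Primrec.succ.comp (Primrec.fst.comp Primrec.snd)) (Primrec.const 2)) Primrec.fst)
        (Primrec.const 0)
    have h2 : PrimrecRel fun (x : ℕ) (y : ℕ × ℕ) => y.2 % x = 0 :=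
      Primrec.eq.comp (Primrec.nat_mod.comp (Primrec.snd.comp Primrec.snd) Primrec.fst)
        (Primrec.const 0)
    have h3 : PrimrecRel fun (x : ℕ) (_ : ℕ × ℕ) => x = 1 :=
      Primrec.eq.comp Primrec.fst (Primrec.const 1)
    exact PrimrecPred.or (PrimrecPred.not (PrimrecPred.and h1 h2)) h3
  have h := hR.forall_mem_list
  have h4 : PrimrecPred fun y : ℕ => 0 < y.unpair.2 :=
    Primrec.nat_lt.comp (Primrec.const 0) (Primrec.snd.comp Primrec.unpair)
  refine (h4.and (h.comp (Primrec.list_range.comp (Primrec.succ.comp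
    (Primrec.snd.comp Primrec.unpair))) Primrec.unpair)).of_eq fun y => ?_
  rw [mem_range_ratCode]
  simp only [Nat.succ_eq_add_one, imp_iff_not_or, List.mem_range]

theorem computable_ratCode : Computable ratCode := by
  let i1 := @Encodable.decidableRangeEncode ℚ Rat.instEncodable
  let i2 : Infinite (Set.range (@Encodable.encode ℚ Rat.instEncodable)) :=
    Infinite.of_injective _
      (Equiv.ofInjective _ (@Encodable.encode_injective ℚ Rat.instEncodable)).injective
  have h : ∀ n, ratCode (Denumerable.ofNat ℚ n) =
      (Nat.Subtype.ofNat (Set.range (@Encodable.encode ℚ Rat.instEncodable)) n : ℕ) := by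
    intro n
    have h1 : Denumerable.ofNat ℚ n = (@Encodable.equivRangeEncode ℚ Rat.instEncodable).symm
        (Nat.Subtype.ofNat (Set.range (@Encodable.encode ℚ Rat.instEncodable)) n) := rfl
    rw [h1]
    exact congrArg Subtype.val (Equiv.apply_symm_apply (@Encodable.equivRangeEncode ℚ
      Rat.instEncodable) (Nat.Subtype.ofNat (Set.range (@Encodable.encode ℚ Rat.instEncodable)) n))
  have hs : Computable fun n => decide (n ∈ Set.range (@Encodable.encode ℚ Rat.instEncodable)) := by
    have := primrecPred_mem_range_ratCode
    obtain ⟨inst, hp⟩ := this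
    refine hp.to_comp.of_eq fun n => ?_
    congr
  refine ((Nat.Subtype.computable_ofNat _ hs).comp Computable.encode).of_eq fun q => ?_
  rw [← h, Denumerable.ofNat_encode]

theorem computable_rat_den : Computable fun q : ℚ => q.den :=
  (Computable.snd.comp (Computable.unpair.comp computable_ratCode)).of_eq fun q => by
    simp [ratCode]

theorem computable_rat_num_toNat : Computable fun q : ℚ => q.num.toNat := by
  have h : Primrec fun c : ℕ => if c % 2 = 0 then c / 2 else 0 :=
    Primrec.ite (Primrec.eq.comp (Primrec.nat_mod.comp Primrec.id (Primrec.const 2))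
      (Primrec.const 0)) (Primrec.nat_div.comp Primrec.id (Primrec.const 2)) (Primrec.const 0)
  refine (h.to_comp.comp (Computable.fst.comp (Computable.unpair.comp computable_ratCode))).of_eq
    fun q => ?_
  simp only [ratCode, Nat.unpair_pair]
  generalize q.num = z
  cases z with
  | ofNat n => rw [Int.ofNat_eq_natCast, encode_int_two_mul]; simp
  | negSucc n => rw [encode_int_negSucc, if_neg (by omega)]; rfl

theorem ratCode_unit_fraction (n : ℕ) : ratCode (1 / ((n : ℚ) + 1)) = Nat.pair 2 (n + 1) := by
  have h : (1 / ((n : ℚ) + 1)) = Rat.divInt 1 ((n + 1 : ℕ) : ℤ) := by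
    rw [Rat.divInt_eq_div]; push_cast; ring
  have h2 : (1 / ((n : ℚ) + 1)).num = 1 ∧ (1 / ((n : ℚ) + 1)).den = n + 1 := by
    have : (1 / ((n : ℚ) + 1)) = ((n + 1 : ℕ) : ℚ)⁻¹ := by push_cast; ring
    rw [this]
    constructor
    · rw [Rat.inv_natCast_num]; simp
    · rw [Rat.inv_natCast_den]; simp
  rw [ratCode, h2.1, h2.2]
  rfl

theorem computable_unit_fraction : Computable fun n : ℕ => (1 / ((n : ℚ) + 1)) := by
  have hp : Computable₂ fun (n m : ℕ) =>
      decide (ratCode (Denumerable.ofNat ℚ m) = Nat.pair 2 (n + 1)) := by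
    have he : Computable fun p : ℕ × ℕ => decide (p.1 = p.2) := by
      obtain ⟨inst, hp⟩ := (Primrec.eq (α := ℕ))
      refine hp.to_comp.of_eq fun n => ?_
      congr
    exact (he.comp (Computable.pair
      (computable_ratCode.comp ((Computable.ofNat ℚ).comp Computable.snd))
      (Primrec₂.natPair.comp (Primrec.const 2) (Primrec.succ.comp Primrec.fst)).to_comp)).to₂
  obtain ⟨f, hf, hfp⟩ := Computable.exists_find hp fun n =>
    ⟨@Encodable.encode ℚ Primcodable.toEncodable (1 / ((n : ℚ) + 1)), by
      rw [decide_eq_true_eq, Denumerable.ofNat_encode, ratCode_unit_fraction]⟩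
  refine ((Computable.ofNat ℚ).comp hf).of_eq fun n => ratCode_injective ?_
  rw [ratCode_unit_fraction]
  simpa using (hfp n).1

/-- A computable measure has natural-number approximations with unit-fraction accuracy, from
above. -/
theorem ComputableMeasure.exists_nat_approx {μ : Measure (ℕ → Bool)}
    (hcomp : ComputableMeasure μ) :
    ∃ E : List Bool → ℕ → ℕ, Computable₂ E ∧ ∀ x K,
      (μ (cyl x)).toReal * (K + 1) ≤ E x K ∧ (E x K : ℝ) ≤ (μ (cyl x)).toReal * (K + 1) + 3 := by
  obtain ⟨f, hf, hfs⟩ := hcomp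
  have hr : Computable₂ fun (x : List Bool) (K : ℕ) => f (x, 1 / ((K : ℚ) + 1)) :=
    hf.comp (Computable.pair Computable.fst (computable_unit_fraction.comp Computable.snd))
  refine ⟨fun x K => (f (x, 1 / ((K : ℚ) + 1))).num.toNat * (K + 1) /
    (f (x, 1 / ((K : ℚ) + 1))).den + 2, ?_, fun x K => ?_⟩
  · have h1 := Primrec.nat_mul.to_comp.comp (computable_rat_num_toNat.comp hr)
      (Computable.succ.comp Computable.snd)
    have h2 := Primrec.nat_div.to_comp.comp h1 (computable_rat_den.comp hr)
    exact Primrec.nat_add.to_comp.comp h2 (Computable.const 2)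
  · have h := hfs x (1 / ((K : ℚ) + 1)) (by positivity)
    set r := f (x, 1 / ((K : ℚ) + 1))
    set p := (μ (cyl x)).toReal
    have hp : 0 ≤ p := ENNReal.toReal_nonneg
    have hK : (0 : ℝ) < K + 1 := by positivity
    push_cast at h
    rw [abs_le] at h
    have hden : (0 : ℝ) < r.den := by exact_mod_cast r.den_pos
    have e1 : (1 : ℝ) / (K + 1) * (K + 1) = 1 := by field_simp
    have hpK1 : p * (K + 1) ≤ r * (K + 1) + 1 := by nlinarith
    have hpK2 : (r : ℝ) * (K + 1) ≤ p * (K + 1) + 1 := by nlinarith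
    have hfl : ((r.num.toNat * (K + 1) / r.den : ℕ) : ℝ) ≤ (r.num.toNat : ℝ) * (K + 1) / r.den := by
      have := @Nat.cast_div_le ℝ _ _ _ (r.num.toNat * (K + 1)) r.den
      push_cast at this
      exact this
    have hfu : (r.num.toNat : ℝ) * (K + 1) / r.den <
        ((r.num.toNat * (K + 1) / r.den : ℕ) : ℝ) + 1 := by
      rw [div_lt_iff₀ hden]
      have := Nat.lt_div_mul_add (a := r.num.toNat * (K + 1)) r.den_pos
      have h3 : ((r.num.toNat * (K + 1) : ℕ) : ℝ) <
        ((r.num.toNat * (K + 1) / r.den * r.den + r.den : ℕ) : ℝ) := by exact_mod_cast this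
      push_cast at h3
      linarith
    have hrd : (r : ℝ) = r.num / r.den := by
      exact_mod_cast (Rat.num_div_den r).symm
    push_cast
    rcases le_total 0 r.num with h0 | h0
    · have hn : ((r.num.toNat : ℕ) : ℝ) = r.num := by
        exact_mod_cast Int.toNat_of_nonneg h0
      have : (r.num.toNat : ℝ) * (K + 1) / r.den = r * (K + 1) := by
        rw [hn, hrd]; ring
      rw [this] at hfl hfu
      constructor <;> linarith
    · have hn : r.num.toNat = 0 := Int.toNat_of_nonpos h0
      have hr0 : (r : ℝ) ≤ 0 := by
        rw [hrd]
        exact div_nonpos_of_nonpos_of_nonneg (by exact_mod_cast h0) hden.le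
      rw [hn]
      simp only [zero_mul, Nat.zero_div, Nat.cast_zero, zero_add]
      constructor <;> nlinarith

end Computability

section ErgodicTheory

variable {α : Type*} [MeasurableSpace α] {μ : Measure α} {T : α → α}

open Classical in
theorem measurable_count_visits (hT : Measurable T) {s : Set α} (hs : MeasurableSet s) (n : ℕ) :
    Measurable fun x => Nat.count (fun j => T^[j] x ∈ s) n := by
  simp only [Nat.count_eq_card_filter_range, Finset.card_filter]
  refine Finset.measurable_sum _ fun j _ => ?_
  exact Measurable.ite ((hT.iterate j) hs) measurable_const measurable_const

open Classical in
/-- Covering lemma behind the maximal inequality: if `E` only contains times from which some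
window of length at most `K` is rich in elements of `G`, then `E` is controlled by `G`. -/
theorem count_le_mul_count_of_rich {G E : ℕ → Prop} {d K : ℕ}
    (hE : ∀ j, E j → ∃ n, n ≤ K ∧ n < d * Nat.count (fun i => G (j + i)) n) (L s : ℕ) :
    Nat.count (fun i => E (s + i)) L ≤ d * Nat.count (fun i => G (s + i)) (L + K) := by
  induction L using Nat.strong_induction_on generalizing s with
  | _ L ih =>
    rcases Nat.eq_zero_or_pos L with rfl | hL
    · simp
    by_cases hs : E s
    · obtain ⟨n, hnK, hn⟩ := hE s hs
      have hn0 : 0 < n := by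
        rcases Nat.eq_zero_or_pos n with rfl | h
        · simp at hn
        · exact h
      rcases le_or_gt L n with hLn | hLn
      · calc Nat.count (fun i => E (s + i)) L ≤ L := Nat.count_le _
          _ ≤ d * Nat.count (fun i => G (s + i)) n := hLn.trans hn.le
          _ ≤ _ := Nat.mul_le_mul_left _ (Nat.count_monotone _ (by omega))
      · obtain ⟨r, rfl⟩ : ∃ r, L = n + r := ⟨L - n, by omega⟩
        have h := ih r (by omega) (s + n)
        rw [Nat.count_add, show n + r + K = n + (r + K) by omega, Nat.count_add, mul_add]
        simp only [← add_assoc] at h ⊢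
        exact Nat.add_le_add ((Nat.count_le _).trans hn.le) h
    · obtain ⟨r, rfl⟩ : ∃ r, L = 1 + r := ⟨L - 1, by omega⟩
      have h := ih r (by omega) (s + 1)
      rw [Nat.count_add, show 1 + r + K = 1 + (r + K) by omega, Nat.count_add, mul_add]
      simp only [← add_assoc] at h ⊢
      have h0 : Nat.count (fun i => E (s + i)) 1 = 0 := by
        simp [Nat.count_succ, hs]
      rw [h0, zero_add]
      exact h.trans (Nat.le_add_left _ _)

open Classical in
theorem lintegral_count_visits (hT : MeasurePreserving T μ μ) {s : Set α} (hs : MeasurableSet s)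
    (n : ℕ) : ∫⁻ x, (Nat.count (fun j => T^[j] x ∈ s) n : ℝ≥0∞) ∂μ = n * μ s := by
  have h : ∀ x, (Nat.count (fun j => T^[j] x ∈ s) n : ℝ≥0∞) =
      ∑ j ∈ Finset.range n, (T^[j] ⁻¹' s).indicator 1 x := by
    intro x
    rw [Nat.count_eq_card_filter_range, Finset.card_filter]
    push_cast
    refine Finset.sum_congr rfl fun j _ => ?_
    simp [Set.indicator_apply]
  simp_rw [h]
  have hm : ∀ j, MeasurableSet (T^[j] ⁻¹' s) := fun j => (hT.measurable.iterate j) hs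
  rw [lintegral_finsetSum _ fun j _ => measurable_one.indicator (hm j)]
  simp_rw [lintegral_indicator_one (hm _), (hT.iterate _).measure_preimage hs.nullMeasurableSet]
  simp

open Classical in
/-- Maximal ergodic inequality for the visits of a measure-preserving map to a set. -/
theorem measure_exists_rich_le [IsProbabilityMeasure μ] (hT : MeasurePreserving T μ μ)
    {V : Set α} (hV : MeasurableSet V) (d : ℕ) :
    μ {x | ∃ n, n < d * Nat.count (fun j => T^[j] x ∈ V) n} ≤ d * μ V := by
  set E : ℕ → Set α := fun K => {x | ∃ n, n ≤ K ∧ n < d * Nat.count (fun j => T^[j] x ∈ V) n}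
  have hEm : ∀ K, MeasurableSet (E K) := by
    intro K
    have : E K = ⋃ n ∈ Set.Iic K, {x | n < d * Nat.count (fun j => T^[j] x ∈ V) n} := by
      ext x; simp [E]
    rw [this]
    refine MeasurableSet.biUnion (Set.to_countable _) fun n _ => ?_
    exact measurableSet_lt measurable_const
      ((measurable_count_visits hT.measurable hV n).const_mul d)
  have hmono : Monotone E := fun K K' h x ⟨n, hn, hx⟩ => ⟨n, hn.trans h, hx⟩
  have hU : {x | ∃ n, n < d * Nat.count (fun j => T^[j] x ∈ V) n} = ⋃ K, E K := by
    ext x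
    simp only [Set.mem_ofPred_eq, Set.mem_iUnion, E]
    exact ⟨fun ⟨n, hn⟩ => ⟨n, n, le_rfl, hn⟩, fun ⟨_, n, _, hn⟩ => ⟨n, hn⟩⟩
  rw [hU, hmono.measure_iUnion]
  refine iSup_le fun K => ?_
  have key : ∀ L : ℕ, (L : ℝ≥0∞) * μ (E K) ≤ d * ((L + K : ℕ) * μ V) := by
    intro L
    have hcm : Measurable fun x => (Nat.count (fun j => T^[j] x ∈ V) (L + K) : ℝ≥0∞) :=
      measurable_from_nat.comp (measurable_count_visits hT.measurable hV _)
    rw [← lintegral_count_visits hT (hEm K), ← lintegral_count_visits hT hV,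
      ← lintegral_const_mul _ hcm]
    refine lintegral_mono fun x => ?_
    have := count_le_mul_count_of_rich (G := fun j => T^[j] x ∈ V) (E := fun j => T^[j] x ∈ E K)
      (d := d) (K := K) (fun j hj => by
        obtain ⟨n, hn, h⟩ := hj
        refine ⟨n, hn, ?_⟩
        simpa only [← Function.iterate_add_apply, add_comm j] using h) L 0
    simp only [zero_add] at this
    rw [← Nat.cast_mul]
    refine Nat.cast_le.2 ?_
    convert this
  have hfin : μ (E K) ≠ ∞ := measure_ne_top _ _
  have hfin' : μ V ≠ ∞ := measure_ne_top _ _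
  rw [← ENNReal.toReal_le_toReal hfin (ENNReal.mul_ne_top (by simp) hfin')]
  set p := (μ (E K)).toReal
  have key' : ∀ L : ℕ, (L : ℝ) * p ≤ d * ((L + K) * (μ V).toReal) := by
    intro L
    have := ENNReal.toReal_mono (by finiteness) (key L)
    simp only [ENNReal.toReal_mul, ENNReal.toReal_natCast] at this
    rwa [Nat.cast_add] at this
  rw [ENNReal.toReal_mul, ENNReal.toReal_natCast]
  by_contra hlt
  push Not at hlt
  obtain ⟨L, hL⟩ := exists_nat_gt (d * K * (μ V).toReal / (p - d * (μ V).toReal))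
  rw [div_lt_iff₀ (by linarith)] at hL
  have := key' L
  nlinarith

/-- **Mean ergodic theorem** for the visit frequencies of an ergodic map: convergence in
measure. -/
theorem tendstoInMeasure_birkhoffAverage_indicator [IsProbabilityMeasure μ] (hT : Ergodic T μ)
    {s : Set α} (hs : MeasurableSet s) :
    TendstoInMeasure μ (fun n x => birkhoffAverage ℝ T (s.indicator (fun _ => (1 : ℝ))) n x) atTop
      (fun _ => μ.real s) := by
  have hp := hT.toMeasurePreserving
  set U : Lp ℝ 2 μ →ₗᵢ[ℝ] Lp ℝ 2 μ := Lp.compMeasurePreservingₗᵢ ℝ T hp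
  set F : Lp ℝ 2 μ := indicatorConstLp 2 hs (measure_ne_top μ s) (1 : ℝ)
  have hconv := U.toContinuousLinearMap.tendsto_birkhoffAverage_orthogonalProjection
    (LinearIsometry.norm_toContinuousLinearMap_le _) F
  set g : Lp ℝ 2 μ := ((U.toContinuousLinearMap.eqLocus (1 : Lp ℝ 2 μ →L[ℝ] Lp ℝ 2 μ)
    ).orthogonalProjectionOnto F : Lp ℝ 2 μ) with hgdef
  have hg : U g = g := by
    exact ((U.toContinuousLinearMap.eqLocus (1 : Lp ℝ 2 μ →L[ℝ] Lp ℝ 2 μ)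
      ).orthogonalProjectionOnto F).2
  have hiter : ∀ j, ((U^[j] F : Lp ℝ 2 μ) : α → ℝ) =ᵐ[μ]
      fun x => s.indicator (fun _ => (1 : ℝ)) (T^[j] x) := by
    intro j
    induction j with
    | zero => exact indicatorConstLp_coeFn (hs := hs) (hμs := measure_ne_top μ s)
    | succ j ih =>
      rw [Function.iterate_succ_apply']
      refine (Lp.coeFn_compMeasurePreserving _ hp).trans ?_
      refine (hp.quasiMeasurePreserving.ae_eq_comp ih).trans ?_
      exact Eventually.of_forall fun x => rfl
  have havg : ∀ n, ((birkhoffAverage ℝ U.toContinuousLinearMap _root_.id n F : Lp ℝ 2 μ) : α → ℝ)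
      =ᵐ[μ] fun x => birkhoffAverage ℝ T (s.indicator (fun _ => (1 : ℝ))) n x := by
    intro n
    simp only [birkhoffAverage, birkhoffSum]
    refine (Lp.coeFn_smul _ _).trans ?_
    have h1 : ((∑ k ∈ Finset.range n, _root_.id (U.toContinuousLinearMap^[k] F) : Lp ℝ 2 μ) : α → ℝ)
        =ᵐ[μ] fun x => ∑ k ∈ Finset.range n, s.indicator (fun _ => (1 : ℝ)) (T^[k] x) := by
      induction n with
      | zero =>
        simp only [Finset.range_zero, Finset.sum_empty]
        exact Lp.coeFn_zero ℝ 2 μ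
      | succ n ih =>
        simp only [Finset.sum_range_succ]
        filter_upwards [Lp.coeFn_add (∑ k ∈ Finset.range n, _root_.id
          (U.toContinuousLinearMap^[k] F)) (_root_.id (U.toContinuousLinearMap^[n] F)), ih,
          hiter n] with x h1 h2 h3
        rw [h1, Pi.add_apply, h2]
        congr 1
    filter_upwards [h1] with x hx
    rw [Pi.smul_apply, hx]
  obtain ⟨c, hc⟩ := hT.ae_eq_const_of_ae_eq_comp_ae (Lp.aestronglyMeasurable g) (by
    have := Lp.coeFn_compMeasurePreserving g hp
    have h2 : Lp.compMeasurePreserving T hp g = g := hg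
    rw [h2] at this
    exact this.symm)
  have hmeas := tendstoInMeasure_of_tendsto_Lp hconv
  have hmeas' : TendstoInMeasure μ
      (fun n x => birkhoffAverage ℝ T (s.indicator (fun _ => (1 : ℝ))) n x) atTop (fun _ => c) :=
    hmeas.congr havg hc
  have hcs : c = μ.real s := by
    set e : Lp ℝ 2 μ := indicatorConstLp 2 MeasurableSet.univ (measure_ne_top μ _) (1 : ℝ)
    have hin : Tendsto (fun n => inner ℝ e
        (birkhoffAverage ℝ U.toContinuousLinearMap _root_.id n F)) atTop (nhds (inner ℝ e g)) :=
      ((innerSL ℝ e).continuous.tendsto _).comp hconv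
    have hintgl : ∀ f : Lp ℝ 2 μ, inner ℝ e f = ∫ x, f x ∂μ := by
      intro f
      rw [L2.inner_indicatorConstLp_one, Measure.restrict_univ]
    have h1 : ∀ n, 0 < n → inner ℝ e (birkhoffAverage ℝ U.toContinuousLinearMap _root_.id n F)
        = μ.real s := by
      intro n hn
      rw [hintgl, integral_congr_ae (havg n)]
      simp only [birkhoffAverage, birkhoffSum]
      rw [integral_smul, integral_finsetSum]
      · have : ∀ k, ∫ x, s.indicator (fun _ => (1 : ℝ)) (T^[k] x) ∂μ = μ.real s := by
          intro k
          have h2 : (fun x => s.indicator (fun _ => (1 : ℝ)) (T^[k] x)) =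
              (T^[k] ⁻¹' s).indicator (fun _ => (1 : ℝ)) := by
            funext x; rfl
          rw [h2, integral_indicator_const _ ((hp.measurable.iterate k) hs), smul_eq_mul, mul_one,
            (hp.iterate k).measureReal_preimage hs.nullMeasurableSet]
        rw [Finset.sum_congr rfl fun k _ => this k, Finset.sum_const, Finset.card_range,
          nsmul_eq_mul, smul_eq_mul]
        field_simp
      · intro k _
        exact (hp.iterate k).integrable_comp_of_integrable ((integrable_const (1 : ℝ)).indicator hs)
    have h2 : inner ℝ e g = c := by
      rw [hintgl, integral_congr_ae hc]
      simp
    rw [h2] at hin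
    refine tendsto_nhds_unique hin (tendsto_const_nhds.congr' ?_)
    filter_upwards [eventually_gt_atTop 0] with n hn
    exact (h1 n hn).symm
  rwa [hcs] at hmeas'

open Classical in
/-- In an ergodic system, the set of points visiting `s` too often up to time `m` has vanishing
measure. -/
theorem tendsto_measure_visits_gt [IsProbabilityMeasure μ] (hT : Ergodic T μ)
    {s : Set α} (hs : MeasurableSet s) {a b : ℕ} (hab : μ.real s * b < a) :
    Tendsto (fun m => μ {x | a * m < b * Nat.count (fun j => T^[j] x ∈ s) m}) atTop (nhds 0) := by
  have h := tendstoInMeasure_birkhoffAverage_indicator hT hs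
  rw [tendstoInMeasure_iff_dist] at h
  have hb : (0 : ℝ) < b + 1 := by positivity
  have hδ : 0 < (a - μ.real s * b) / (b + 1) := div_pos (by linarith) hb
  refine tendsto_of_tendsto_of_tendsto_of_le_of_le tendsto_const_nhds (h _ hδ)
    (fun _ => zero_le) fun m => measure_mono fun x hx => ?_
  simp only [Set.mem_ofPred_eq] at hx ⊢
  have hm : 0 < m := by
    rcases Nat.eq_zero_or_pos m with rfl | h
    · simp at hx
    · exact h
  have hm' : (0 : ℝ) < m := by exact_mod_cast hm
  have hav : birkhoffAverage ℝ T (s.indicator (fun _ => (1 : ℝ))) m x =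
      (m : ℝ)⁻¹ * Nat.count (fun j => T^[j] x ∈ s) m := by
    rw [Nat.count_eq_card_filter_range]
    simp [birkhoffAverage, birkhoffSum, Set.indicator_apply]
  rw [hav, Real.dist_eq]
  refine le_trans ?_ (le_abs_self _)
  set C := Nat.count (fun j => T^[j] x ∈ s) m
  have hx' : (a : ℝ) * m < b * C := by exact_mod_cast hx
  have h3 : (a : ℝ) ≤ b * ((m : ℝ)⁻¹ * C) := by
    rw [← mul_le_mul_iff_left₀ hm']
    have : (b : ℝ) * ((m : ℝ)⁻¹ * C) * m = b * C := by field_simp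
    rw [this]; exact hx'.le
  rw [div_le_iff₀ hb]
  have hq : μ.real s ≤ (m : ℝ)⁻¹ * C := by
    by_contra hlt
    push Not at hlt
    have : (b : ℝ) * ((m : ℝ)⁻¹ * C) ≤ b * μ.real s :=
      mul_le_mul_of_nonneg_left hlt.le (by positivity)
    linarith
  nlinarith

end ErgodicTheory

section Words

theorem length_pre (ω : ℕ → Bool) (n : ℕ) : (pre ω n).length = n := by simp [pre]

theorem getElem_pre (ω : ℕ → Bool) (n i : ℕ) (h : i < (pre ω n).length) : (pre ω n)[i] = ω i := by
  simp [pre]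

theorem mem_cyl_iff_pre_eq {ω : ℕ → Bool} {x : List Bool} : ω ∈ cyl x ↔ pre ω x.length = x := by
  constructor
  · intro h
    refine List.ext_getElem (length_pre _ _) fun i h1 h2 => ?_
    rw [getElem_pre, h i h2, List.getD_eq_getElem _ _ h2]
  · intro h i hi
    rw [List.getD_eq_getElem _ _ hi]
    conv_rhs => rw [List.getElem_of_eq h.symm hi]
    rw [getElem_pre]

theorem mem_cyl_pre (ω : ℕ → Bool) (n : ℕ) : ω ∈ cyl (pre ω n) := by
  rw [mem_cyl_iff_pre_eq, length_pre]

theorem iterate_shift_apply (ω : ℕ → Bool) (j i : ℕ) : shift^[j] ω i = ω (j + i) := by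
  induction j generalizing i with
  | zero => simp
  | succ j ih => rw [Function.iterate_succ_apply', shift, ih]; congr 1; omega

theorem drop_pre (ω : ℕ → Bool) (n j : ℕ) : (pre ω n).drop j = pre (shift^[j] ω) (n - j) := by
  refine List.ext_getElem (by simp [length_pre]) fun i h1 h2 => ?_
  simp [getElem_pre, iterate_shift_apply]

theorem take_pre (ω : ℕ → Bool) (n j : ℕ) : (pre ω n).take j = pre ω (min j n) := by
  refine List.ext_getElem (by simp [length_pre]) fun i h1 h2 => ?_
  simp [getElem_pre]

theorem pre_succ (ω : ℕ → Bool) (n : ℕ) : pre ω (n + 1) = pre ω n ++ [ω n] := by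
  rw [pre, List.ofFn_succ_last]
  rfl

theorem measurableSet_cyl (x : List Bool) : MeasurableSet (cyl x) := by
  have : cyl x = ⋂ i : Fin x.length, (fun ω : ℕ → Bool => ω i) ⁻¹' {x.getD i false} := by
    ext ω
    simp only [cyl, Set.mem_ofPred_eq, Set.mem_iInter, Set.mem_preimage, Set.mem_singleton_iff]
    exact ⟨fun h i => h i i.2, fun h i hi => h ⟨i, hi⟩⟩
  rw [this]
  exact MeasurableSet.iInter fun i => measurable_pi_apply _ (measurableSet_singleton _)

theorem mem_cyl_append_singleton {ω : ℕ → Bool} {x : List Bool} {b : Bool} :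
    ω ∈ cyl (x ++ [b]) ↔ ω ∈ cyl x ∧ ω x.length = b := by
  simp only [mem_cyl_iff_pre_eq, List.length_append, List.length_singleton, pre_succ]
  refine ⟨fun h => ?_, fun ⟨h1, h2⟩ => by rw [h1, h2]⟩
  have := List.append_inj h (length_pre _ _)
  simpa using this

theorem measure_cyl_inter_eq_add (μ : Measure (ℕ → Bool)) (A : Set (ℕ → Bool)) (x : List Bool) :
    μ (A ∩ cyl x) = μ (A ∩ cyl (x ++ [false])) + μ (A ∩ cyl (x ++ [true])) := by
  rw [← measure_inter_add_sdiff (A ∩ cyl x) (measurableSet_cyl (x ++ [false]))]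
  congr 2
  · ext ω; simp only [Set.mem_inter_iff, mem_cyl_append_singleton]; tauto
  · ext ω
    simp only [Set.mem_inter_iff, Set.mem_sdiff, mem_cyl_append_singleton]
    cases ω x.length <;> simp

theorem measure_cyl_eq_add (μ : Measure (ℕ → Bool)) (x : List Bool) :
    μ (cyl x) = μ (cyl (x ++ [false])) + μ (cyl (x ++ [true])) := by
  simpa using measure_cyl_inter_eq_add μ Set.univ x

/-- The list of all binary words of length `l`. -/
def words (l : ℕ) : List (List Bool) :=
  Nat.rec [[]] (fun _ L => L.flatMap fun x => [x ++ [false], x ++ [true]]) l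

theorem words_succ (l : ℕ) :
    words (l + 1) = (words l).flatMap fun x => [x ++ [false], x ++ [true]] := rfl

theorem length_of_mem_words {l : ℕ} {x : List Bool} (hx : x ∈ words l) : x.length = l := by
  induction l generalizing x with
  | zero => simp_all [words]
  | succ l ih =>
    rw [words_succ, List.mem_flatMap] at hx
    obtain ⟨y, hy, h⟩ := hx
    have := ih hy
    simp only [List.mem_cons, List.not_mem_nil, or_false] at h
    rcases h with rfl | rfl <;> simp [this]

theorem sum_map_flatMap_pair {M α : Type*} [AddCommMonoid M] (f : α → M) (g h : α → α)
    (L : List α) :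
    ((L.flatMap fun x => [g x, h x]).map f).sum = (L.map fun x => f (g x) + f (h x)).sum := by
  induction L with
  | nil => simp
  | cons a L ih => simp [ih, add_assoc]

theorem sum_words_measure_inter (μ : Measure (ℕ → Bool)) (A : Set (ℕ → Bool)) (l : ℕ) :
    ((words l).map fun x => μ (A ∩ cyl x)).sum = μ A := by
  induction l with
  | zero => simp [words, cyl]
  | succ l ih =>
    rw [words_succ, sum_map_flatMap_pair (fun x => μ (A ∩ cyl x)), ← ih]
    simp_rw [← measure_cyl_inter_eq_add]

theorem exists_measure_cyl_le (μ : Measure (ℕ → Bool)) [IsProbabilityMeasure μ] (l : ℕ) :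
    ∃ x, μ.real (cyl x) ≤ (1 / 2) ^ l := by
  induction l with
  | zero => exact ⟨[], by simp⟩
  | succ l ih =>
    obtain ⟨x, hx⟩ := ih
    have h : μ.real (cyl x) = μ.real (cyl (x ++ [false])) + μ.real (cyl (x ++ [true])) := by
      rw [measureReal_def, measure_cyl_eq_add,
        ENNReal.toReal_add (measure_ne_top _ _) (measure_ne_top _ _)]
      rfl
    rcases le_total (μ.real (cyl (x ++ [false]))) (μ.real (cyl (x ++ [true]))) with h' | h'
    · exact ⟨x ++ [false], by rw [pow_succ]; linarith⟩
    · exact ⟨x ++ [true], by rw [pow_succ]; linarith⟩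

end Words

section Frequencies

theorem PrimrecRel.nat_count {α : Type*} [Primcodable α] {R : ℕ → α → Prop} [DecidableRel R]
    (hR : PrimrecRel R) : Primrec₂ fun (m : ℕ) a => Nat.count (fun j => R j a) m := by
  have h := Primrec.list_length.comp
    (hR.listFilter.comp (Primrec.list_range.comp (Primrec.fst (α := ℕ) (β := α))) Primrec.snd)
  refine h.of_eq fun ⟨m, a⟩ => ?_
  simp only
  induction m with
  | zero => simp
  | succ m ih =>
    rw [List.range_succ, List.filter_append, List.length_append, ih, Nat.count_succ]
    by_cases h : R m a <;> simp [h]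

/-- Number of occurrences of `w` in `x` at the positions `< m`. -/
def occ (w : List Bool) (m : ℕ) (x : List Bool) : ℕ :=
  Nat.count (fun j => (x.drop j).take w.length = w) m

/-- The frequency of `w` in `x` up to position `m` exceeds `a / b`. -/
def Heavy (a b : ℕ) (w : List Bool) (m : ℕ) (x : List Bool) : Prop := a * m < b * occ w m x

instance (a b : ℕ) (w : List Bool) (m : ℕ) (x : List Bool) : Decidable (Heavy a b w m x) :=
  inferInstanceAs (Decidable (_ < _))

/-- Some initial segment of `x` has a proportion at least `1 / d` of heavy positions. -/
def Rich (a b d : ℕ) (w : List Bool) (m : ℕ) (x : List Bool) : Prop :=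
  ∃ n ∈ List.range (x.length + 1), n < d * Nat.count (fun j => Heavy a b w m (x.drop j)) n

theorem primrec_occ (w : List Bool) : Primrec₂ (occ w) := by
  refine PrimrecRel.nat_count (R := fun j (x : List Bool) => (x.drop j).take w.length = w) ?_
  exact Primrec.eq.comp (Primrec.list_take.comp (Primrec.const _) Primrec.list_drop)
    (Primrec.const _)

theorem primrec_heavy (a b : ℕ) (w : List Bool) : PrimrecRel (Heavy a b w) :=
  Primrec.nat_lt.comp (Primrec.nat_mul.comp (Primrec.const a) Primrec.fst)
    (Primrec.nat_mul.comp (Primrec.const b) (primrec_occ w))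

theorem primrec_rich (a b d : ℕ) (w : List Bool) : PrimrecRel (Rich a b d w) := by
  have h1 : PrimrecRel fun (j : ℕ) (p : ℕ × List Bool) => Heavy a b w p.1 (p.2.drop j) :=
    (primrec_heavy a b w).comp (Primrec.fst.comp Primrec.snd)
      (Primrec.list_drop.comp Primrec.fst (Primrec.snd.comp Primrec.snd))
  have h2 : PrimrecRel fun (n : ℕ) (p : ℕ × List Bool) =>
      n < d * Nat.count (fun j => Heavy a b w p.1 (p.2.drop j)) n :=
    Primrec.nat_lt.comp Primrec.fst (Primrec.nat_mul.comp (Primrec.const d) h1.nat_count)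
  exact h2.exists_mem_list.comp (Primrec.list_range.comp
    (Primrec.succ.comp (Primrec.list_length.comp Primrec.snd))) Primrec.id

theorem primrec_words : Primrec words := by
  refine Primrec.nat_rec₁ [[]] (f := fun _ L => L.flatMap fun x => [x ++ [false], x ++ [true]]) ?_
  refine Primrec.list_flatMap Primrec.snd ?_
  exact Primrec.list_cons.comp (Primrec.list_append.comp Primrec.snd (Primrec.const _))
    (Primrec.list_cons.comp (Primrec.list_append.comp Primrec.snd (Primrec.const _))
      (Primrec.const _))

theorem computable_sum_map {f : List Bool → ℕ → ℕ} (hf : Computable₂ f) :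
    Computable₂ fun (L : List (List Bool)) (K : ℕ) => (L.map fun x => f x K).sum := by
  have hstep : Computable₂ fun (p : List (List Bool) × ℕ) (q : ℕ × ℕ) =>
      q.2 + f (p.1.getD q.1 []) p.2 := by
    refine Primrec.nat_add.to_comp.comp (Computable.snd.comp Computable.snd)
      (hf.comp ((Primrec.list_getD []).to_comp.comp (Computable.fst.comp Computable.fst)
        (Computable.fst.comp Computable.snd)) (Computable.snd.comp Computable.fst))
  refine (Computable.nat_rec (Computable.list_length.comp Computable.fst) (Computable.const 0)
    hstep).of_eq fun ⟨L, K⟩ => ?_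
  have key : ∀ n ≤ L.length, (Nat.rec (motive := fun _ => ℕ) 0
      (fun y IH => IH + f (L.getD y []) K) n) = ((L.take n).map fun x => f x K).sum := by
    intro n hn
    induction n with
    | zero => simp
    | succ n ih =>
      simp only [ih (by omega)]
      rw [List.take_add_one, List.getElem?_eq_getElem (by omega),
        List.getD_eq_getElem _ _ (by omega)]
      simp only [Option.toList_some, List.map_append, List.sum_append, List.map_cons,
        List.map_nil, List.sum_singleton]
  simpa using key L.length le_rfl

end Frequencies

section RandomFrequencies

theorem Nat.count_le_count_of_imp {p q : ℕ → Prop} {_ : DecidablePred p} {_ : DecidablePred q}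
    {n : ℕ}
    (h : ∀ j < n, p j → q j) : Nat.count p n ≤ Nat.count q n := by
  rw [Nat.count_eq_card_filter_range, Nat.count_eq_card_filter_range]
  refine Finset.card_le_card fun j hj => ?_
  simp only [Finset.mem_filter, Finset.mem_range] at hj ⊢
  exact ⟨hj.1, h j hj.1 hj.2⟩

open Classical in
/-- The sequences in which the frequency of `w` up to time `m` exceeds `a / b`. -/
def heavySet (a b : ℕ) (w : List Bool) (m : ℕ) : Set (ℕ → Bool) :=
  {ω | a * m < b * Nat.count (fun j => shift^[j] ω ∈ cyl w) m}

open Classical in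
/-- The sequences with a window rich in visits to `heavySet a b w m`. -/
def richSet (a b d : ℕ) (w : List Bool) (m : ℕ) : Set (ℕ → Bool) :=
  {ω | ∃ n, n < d * Nat.count (fun j => shift^[j] ω ∈ heavySet a b w m) n}

theorem mem_cyl_of_take_drop_pre {ω : ℕ → Bool} {w : List Bool} {l j : ℕ}
    (h : ((pre ω l).drop j).take w.length = w) : shift^[j] ω ∈ cyl w := by
  rw [drop_pre, take_pre] at h
  have hl := congrArg List.length h
  rw [length_pre] at hl
  rw [hl] at h
  rwa [mem_cyl_iff_pre_eq]

theorem take_drop_pre_eq_iff {ω : ℕ → Bool} {w : List Bool} {l j : ℕ} (hl : j + w.length ≤ l) :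
    ((pre ω l).drop j).take w.length = w ↔ shift^[j] ω ∈ cyl w := by
  rw [drop_pre, take_pre, mem_cyl_iff_pre_eq, min_eq_left (by omega)]

theorem Heavy.mem_heavySet {a b m l : ℕ} {w : List Bool} {ω : ℕ → Bool}
    (h : Heavy a b w m (pre ω l)) : ω ∈ heavySet a b w m := by
  refine lt_of_lt_of_le h (Nat.mul_le_mul_left _ ?_)
  exact Nat.count_le_count_of_imp fun j _ hj => mem_cyl_of_take_drop_pre hj

theorem heavy_pre_iff {a b m l : ℕ} {w : List Bool} {ω : ℕ → Bool} (hl : m + w.length ≤ l) :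
    Heavy a b w m (pre ω l) ↔ ω ∈ heavySet a b w m := by
  refine ⟨Heavy.mem_heavySet, fun h => lt_of_lt_of_le h (Nat.mul_le_mul_left _ ?_)⟩
  exact Nat.count_le_count_of_imp fun j hjm hj => (take_drop_pre_eq_iff (by omega)).2 hj

theorem Rich.mem_richSet {a b d m : ℕ} {w x : List Bool} {ω : ℕ → Bool}
    (h : Rich a b d w m x) (hx : ω ∈ cyl x) : ω ∈ richSet a b d w m := by
  obtain ⟨n, -, hn⟩ := h
  rw [mem_cyl_iff_pre_eq] at hx
  refine ⟨n, lt_of_lt_of_le hn (Nat.mul_le_mul_left _ ?_)⟩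
  refine Nat.count_le_count_of_imp fun j _ hj => ?_
  rw [← hx, drop_pre] at hj
  exact hj.mem_heavySet

theorem exists_rich_of_mem_richSet {a b d m : ℕ} {w : List Bool} {ω : ℕ → Bool}
    (h : ω ∈ richSet a b d w m) : ∃ x, Rich a b d w m x ∧ ω ∈ cyl x := by
  obtain ⟨n, hn⟩ := h
  refine ⟨pre ω (n + m + w.length), ⟨n, ?_, lt_of_lt_of_le hn (Nat.mul_le_mul_left _ ?_)⟩,
    mem_cyl_pre _ _⟩
  · rw [List.mem_range, length_pre]; omega
  · refine Nat.count_le_count_of_imp fun j hjn hj => ?_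
    rw [drop_pre, heavy_pre_iff (by omega)]
    exact hj

theorem measurable_shift : Measurable shift :=
  measurable_pi_lambda _ fun i => measurable_pi_apply (i + 1)

theorem measurableSet_heavySet (a b : ℕ) (w : List Bool) (m : ℕ) :
    MeasurableSet (heavySet a b w m) :=
  measurableSet_lt measurable_const
    ((measurable_count_visits measurable_shift (measurableSet_cyl w) m).const_mul b)

theorem sum_words_heavy (μ : Measure (ℕ → Bool)) (a b : ℕ) (w : List Bool) (m : ℕ) :
    (((words (m + w.length)).filter (Heavy a b w m ·)).map fun x => μ (cyl x)).sum =
      μ (heavySet a b w m) := by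
  rw [← sum_words_measure_inter μ (heavySet a b w m) (m + w.length)]
  have key : ∀ L : List (List Bool), (∀ x ∈ L, x.length = m + w.length) →
      ((L.filter (Heavy a b w m ·)).map fun x => μ (cyl x)).sum =
        (L.map fun x => μ (heavySet a b w m ∩ cyl x)).sum := by
    intro L hL
    induction L with
    | nil => simp
    | cons x L ih =>
      have hx := hL x (by simp)
      have hpre : ∀ ω ∈ cyl x, (Heavy a b w m x ↔ ω ∈ heavySet a b w m) := by
        intro ω hω
        rw [mem_cyl_iff_pre_eq, hx] at hω
        rw [← hω]
        exact heavy_pre_iff le_rfl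
      have ih := ih fun y hy => hL y (by simp [hy])
      by_cases h : Heavy a b w m x
      · rw [List.filter_cons_of_pos (by simpa using h), List.map_cons, List.sum_cons, ih,
          List.map_cons, List.sum_cons, Set.inter_eq_right.2 fun ω hω => (hpre ω hω).1 h]
      · have : heavySet a b w m ∩ cyl x = ∅ := by
          ext ω
          simp only [Set.mem_inter_iff, Set.mem_empty_iff_false, iff_false, not_and]
          exact fun h1 h2 => h ((hpre ω h2).2 h1)
        rw [List.filter_cons_of_neg (by simpa using h), ih, List.map_cons, List.sum_cons, this]
        simp
  exact key _ fun x hx => length_of_mem_words hx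

theorem sum_approx_bounds {L : List (List Bool)} {μ : Measure (ℕ → Bool)} [IsProbabilityMeasure μ]
    {E : List Bool → ℕ → ℕ} {K : ℕ}
    (hE : ∀ x, (μ (cyl x)).toReal * (K + 1) ≤ E x K ∧
      (E x K : ℝ) ≤ (μ (cyl x)).toReal * (K + 1) + 3) :
    ((L.map fun x => μ (cyl x)).sum).toReal * (K + 1) ≤ (L.map fun x => E x K).sum ∧
      ((L.map fun x => E x K).sum : ℝ) ≤
        ((L.map fun x => μ (cyl x)).sum).toReal * (K + 1) + 3 * L.length ∧
      (L.map fun x => μ (cyl x)).sum ≠ ∞ := by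
  induction L with
  | nil => simp
  | cons x L ih =>
    obtain ⟨h1, h2, h3⟩ := ih
    simp only [List.map_cons, List.sum_cons, List.length_cons]
    rw [ENNReal.toReal_add (measure_ne_top _ _) h3]
    rw [Nat.cast_add, Nat.cast_add, Nat.cast_one]
    refine ⟨?_, ?_, by finiteness⟩
    · linarith [(hE x).1]
    · linarith [(hE x).2]

/-- Counting visits over all windows of length `m` counts most visits `m` times. -/
theorem mul_count_le_sum_count_window (p : ℕ → Prop) [DecidablePred p] (n m : ℕ) :
    m * Nat.count p n ≤ ∑ j ∈ Finset.range n, Nat.count (fun i => p (j + i)) m + m * m := by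
  have h1 : ∀ i < m, Nat.count p n ≤ (∑ j ∈ Finset.range n, if p (j + i) then 1 else 0) + m := by
    intro i hi
    have h2 : (∑ j ∈ Finset.range n, if p (j + i) then 1 else 0) =
        Nat.count (fun j => p (i + j)) n := by
      rw [Nat.count_eq_card_filter_range, Finset.card_filter]
      simp_rw [add_comm i]
    have h3 := Nat.count_add p i n
    have h4 : Nat.count p n ≤ Nat.count p (i + n) := Nat.count_monotone p (by omega)
    have h5 : Nat.count p i ≤ i := Nat.count_le _
    omega
  have h2 : ∑ j ∈ Finset.range n, Nat.count (fun i => p (j + i)) m =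
      ∑ i ∈ Finset.range m, ∑ j ∈ Finset.range n, if p (j + i) then 1 else 0 := by
    rw [Finset.sum_comm]
    refine Finset.sum_congr rfl fun j _ => ?_
    rw [Nat.count_eq_card_filter_range, Finset.card_filter]
  have h3 := Finset.sum_le_sum fun i hi => h1 i (Finset.mem_range.1 hi)
  rw [h2]
  simpa [Finset.sum_add_distrib] using h3

open Classical in
theorem mem_richSet_of_frequently {a b d m : ℕ} {w : List Bool} {ω : ℕ → Bool} (hm : 0 < m)
    (h : ∃ᶠ n in atTop,
      (a * d + 2 * b) * n < b * d * Nat.count (fun j => shift^[j] ω ∈ cyl w) n) :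
    ω ∈ richSet a b d w m := by
  obtain ⟨n, hn, hnd⟩ := (h.and_eventually (eventually_ge_atTop (d * m))).exists
  refine ⟨n, ?_⟩
  by_contra hlt
  push Not at hlt
  set C := Nat.count (fun j => shift^[j] ω ∈ cyl w) n
  set D := Nat.count (fun j => shift^[j] ω ∈ heavySet a b w m) n with hD
  have h1 := mul_count_le_sum_count_window (fun j => shift^[j] ω ∈ cyl w) n m
  have h2 : ∀ j, b * Nat.count (fun i => shift^[j + i] ω ∈ cyl w) m ≤
      a * m + b * m * (if shift^[j] ω ∈ heavySet a b w m then 1 else 0) := by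
    intro j
    have h3 : Nat.count (fun i => shift^[j + i] ω ∈ cyl w) m ≤ m := Nat.count_le _
    split_ifs with hj
    · nlinarith
    · simp only [heavySet, Set.mem_ofPred_eq, not_lt, ← Function.iterate_add_apply] at hj
      simpa only [add_comm j, mul_zero, add_zero] using hj
  have h3 := Finset.sum_le_sum fun j (_ : j ∈ Finset.range n) => h2 j
  rw [← Finset.mul_sum, Finset.sum_add_distrib, Finset.sum_const,
    Finset.card_range, smul_eq_mul, ← Finset.mul_sum, ← Finset.card_filter,
    ← Nat.count_eq_card_filter_range,
    ← hD] at h3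
  have h4 : m * (b * C) ≤ m * (n * a + b * D + b * m) := by
    have := Nat.mul_le_mul_left b h1
    nlinarith
  have h5 := Nat.le_of_mul_le_mul_left h4 hm
  have h6 : b * d * C ≤ n * a * d + b * (d * D) + b * (d * m) := by nlinarith
  have h7 : b * (d * D) ≤ b * n := Nat.mul_le_mul_left _ hlt
  have h8 : b * (d * m) ≤ b * n := Nat.mul_le_mul_left _ hnd
  nlinarith


theorem exists_small_heavySet {μ : Measure (ℕ → Bool)} [IsProbabilityMeasure μ]
    {E : List Bool → ℕ → ℕ} (hE : ∀ x K, (μ (cyl x)).toReal * (K + 1) ≤ E x K ∧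
      (E x K : ℝ) ≤ (μ (cyl x)).toReal * (K + 1) + 3) (herg : Ergodic shift μ)
    {a b : ℕ} {w : List Bool} (hab : μ.real (cyl w) * b < a) {D : ℕ} (hD : 0 < D) :
    ∃ m K, D * (((words (m + 1 + w.length)).filter (Heavy a b w (m + 1) ·)).map
      fun x => E x K).sum < K + 1 := by
  have h := (ENNReal.tendsto_toReal (by simp)).comp
    (tendsto_measure_visits_gt herg (measurableSet_cyl w) hab)
  rw [ENNReal.toReal_zero] at h
  have hD' : (0 : ℝ) < D := by exact_mod_cast hD
  obtain ⟨m, hm, hm0⟩ := ((h.eventually_lt_const (one_div_pos.2 hD')).and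
    (eventually_gt_atTop 0)).exists
  obtain ⟨m, rfl⟩ : ∃ k, m = k + 1 := ⟨m - 1, by omega⟩
  have hm' : (μ (heavySet a b w (m + 1))).toReal * D < 1 := by
    rwa [← lt_div_iff₀ hD']
  set L := (words (m + 1 + w.length)).filter (Heavy a b w (m + 1) ·) with hL
  obtain ⟨K, hK⟩ := exists_nat_gt (3 * L.length * D / (1 - (μ (heavySet a b w (m + 1))).toReal * D))
  refine ⟨m, K, ?_⟩
  have h2 := (sum_approx_bounds (L := L) fun x => hE x K).2.1
  rw [hL, sum_words_heavy, ← hL] at h2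
  rw [div_lt_iff₀ (by linarith)] at hK
  have h3 : ((D * (L.map fun x => E x K).sum : ℕ) : ℝ) < (K + 1 : ℕ) := by
    rw [Nat.cast_mul]
    push_cast [-Nat.cast_list_sum] at h2 ⊢
    nlinarith
  exact_mod_cast h3

theorem exists_small_cyl {μ : Measure (ℕ → Bool)} [IsProbabilityMeasure μ]
    {E : List Bool → ℕ → ℕ} (hE : ∀ x K, (μ (cyl x)).toReal * (K + 1) ≤ E x K ∧
      (E x K : ℝ) ≤ (μ (cyl x)).toReal * (K + 1) + 3) {D : ℕ} (hD : 0 < D) :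
    ∃ x K, D * E x K < K + 1 := by
  have hD' : (0 : ℝ) < D := by exact_mod_cast hD
  obtain ⟨l, hl⟩ := exists_pow_lt_of_lt_one (show (0 : ℝ) < 1 / D by positivity)
    (show (1 / 2 : ℝ) < 1 by norm_num)
  obtain ⟨x, hx⟩ := exists_measure_cyl_le μ l
  have hx' : (μ (cyl x)).toReal * D < 1 := by
    rw [← lt_div_iff₀ hD']
    exact hx.trans_lt hl
  obtain ⟨K, hK⟩ := exists_nat_gt (3 * D / (1 - (μ (cyl x)).toReal * D))
  rw [div_lt_iff₀ (by linarith)] at hK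
  refine ⟨x, K, ?_⟩
  have h3 : ((D * E x K : ℕ) : ℝ) < (K + 1 : ℕ) := by
    have := (hE x K).2
    push_cast
    nlinarith
  exact_mod_cast h3

open Classical in
/-- The set of sequences in which the word `w` is infinitely often more frequent than
`a / b + 2 / d` is effectively null when `a / b` exceeds the probability of `w`. -/
theorem effNull_frequently_count {μ : Measure (ℕ → Bool)} [IsProbabilityMeasure μ]
    (hcomp : ComputableMeasure μ) (herg : Ergodic shift μ)
    {a b : ℕ} (d : ℕ) {w : List Bool} (hab : μ.real (cyl w) * b < a) :
    EffNull μ {ω | ∃ᶠ n in atTop,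
      (a * d + 2 * b) * n < b * d * Nat.count (fun j => shift^[j] ω ∈ cyl w) n} := by
  obtain ⟨E, hEc, hE⟩ := hcomp.exists_nat_approx
  -- search for a length `m + 1` at which the heavy set is small
  have hsum : Computable₂ fun (m K : ℕ) =>
      (((words (m + 1 + w.length)).filter (Heavy a b w (m + 1) ·)).map fun x => E x K).sum := by
    refine (computable_sum_map hEc).comp (Primrec.to_comp ?_) Computable.snd
    have hR : PrimrecRel fun (x : List Bool) (m : ℕ) => Heavy a b w m x :=
      (primrec_heavy a b w).comp Primrec.snd Primrec.fst
    exact hR.listFilter.comp (primrec_words.comp (Primrec.nat_add.comp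
      (Primrec.succ.comp Primrec.fst) (Primrec.const _))) (Primrec.succ.comp Primrec.fst)
  have hp1 : Computable₂ fun (D n : ℕ) => decide ((D + 1) * (((words (n.unpair.1 + 1 +
      w.length)).filter (Heavy a b w (n.unpair.1 + 1) ·)).map fun x => E x n.unpair.2).sum <
        n.unpair.2 + 1) := by
    refine Primrec.nat_lt.decide.to_comp.comp (Primrec.nat_mul.to_comp.comp
      (Computable.succ.comp Computable.fst) (hsum.comp (Computable.fst.comp
        (Computable.unpair.comp Computable.snd)) (Computable.snd.comp
        (Computable.unpair.comp Computable.snd)))) (Computable.succ.comp (Computable.snd.comp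
        (Computable.unpair.comp Computable.snd)))
  obtain ⟨F, hFc, hF⟩ := Computable.exists_find hp1 fun D => by
    obtain ⟨m, K, h⟩ := exists_small_heavySet hE herg hab (Nat.succ_pos D)
    exact ⟨Nat.pair m K, by simpa using h⟩
  -- search for a cylinder of small measure
  have hp2 : Computable₂ fun (D n : ℕ) => decide ((D + 1) * E ((Encodable.decode (α := List Bool)
      n.unpair.1).getD []) n.unpair.2 < n.unpair.2 + 1) := by
    refine Primrec.nat_lt.decide.to_comp.comp (Primrec.nat_mul.to_comp.comp
      (Computable.succ.comp Computable.fst) (hEc.comp (Computable.option_getD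
        (Computable.decode.comp (Computable.fst.comp (Computable.unpair.comp Computable.snd)))
        (Computable.const [])) (Computable.snd.comp
        (Computable.unpair.comp Computable.snd)))) (Computable.succ.comp (Computable.snd.comp
        (Computable.unpair.comp Computable.snd)))
  obtain ⟨G, hGc, hG⟩ := Computable.exists_find hp2 fun D => by
    obtain ⟨x, K, h⟩ := exists_small_cyl hE (Nat.succ_pos D)
    exact ⟨Nat.pair (Encodable.encode x) K, by simpa using h⟩
  set M : ℕ → ℕ := fun D => (F D).unpair.1 + 1 with hM
  set Y : ℕ → List Bool := fun D => (Encodable.decode (α := List Bool) (G D).unpair.1).getD []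
    with hY
  have hMc : Computable M := Computable.succ.comp (Computable.fst.comp (Computable.unpair.comp hFc))
  have hYc : Computable Y := Computable.option_getD (Computable.decode.comp
    (Computable.fst.comp (Computable.unpair.comp hGc))) (Computable.const [])
  have hMs : ∀ D, (D + 1) * μ.real (heavySet a b w (M D)) < 1 := by
    intro D
    have h1 := (hF D).1
    simp only [decide_eq_true_eq] at h1
    have h2 := (sum_approx_bounds (L := (words (M D + w.length)).filter (Heavy a b w (M D) ·))
      fun x => hE x (F D).unpair.2).1
    rw [sum_words_heavy] at h2
    have h3 : ((D + 1 : ℕ) : ℝ) * ((((words (M D + w.length)).filter (Heavy a b w (M D) ·)).map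
      fun x => E x (F D).unpair.2).sum : ℕ) < ((F D).unpair.2 + 1 : ℕ) := by exact_mod_cast h1
    push_cast [-Nat.cast_list_sum] at h3
    have h4 := mul_le_mul_of_nonneg_left h2 (show (0 : ℝ) ≤ D + 1 by positivity)
    have h5 : (0 : ℝ) < (F D).unpair.2 + 1 := by positivity
    rw [← mul_lt_mul_iff_left₀ h5, one_mul, mul_assoc]
    exact h4.trans_lt h3
  have hYs : ∀ D, (D + 1) * μ.real (cyl (Y D)) < 1 := by
    intro D
    have h1 := (hG D).1
    simp only [decide_eq_true_eq] at h1
    have h2 := (hE (Y D) (G D).unpair.2).1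
    have h3 : ((D + 1 : ℕ) : ℝ) * (E (Y D) (G D).unpair.2 : ℕ) < ((G D).unpair.2 + 1 : ℕ) := by
      exact_mod_cast h1
    push_cast at h3
    have h4 := mul_le_mul_of_nonneg_left h2 (show (0 : ℝ) ≤ D + 1 by positivity)
    have h5 : (0 : ℝ) < (G D).unpair.2 + 1 := by positivity
    rw [← mul_lt_mul_iff_left₀ h5, one_mul, mul_assoc]
    exact h4.trans_lt h3
  set W : ℚ → ℕ := fun ε => (d + 2) * ε.den with hW
  have hWc : Computable W := Primrec.nat_mul.to_comp.comp (Computable.const _) computable_rat_den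
  have hdec : Computable₂ fun (m : ℕ) (x : List Bool) => decide (Rich a b d w m x) := by
    have := (primrec_rich a b d w).decide
    exact this.to_comp
  let g : ℚ × ℕ → List Bool := fun p =>
    bif decide (Rich a b d w (M (W p.1)) ((Encodable.decode (α := List Bool) p.2).getD []))
      then (Encodable.decode (α := List Bool) p.2).getD [] else Y (W p.1)
  have hgc : Computable g := by
    have hx : Computable fun p : ℚ × ℕ => (Encodable.decode (α := List Bool) p.2).getD [] :=
      Computable.option_getD (Computable.decode.comp Computable.snd) (Computable.const [])
    exact Computable.cond (hdec.comp (hMc.comp (hWc.comp Computable.fst)) hx) hx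
      (hYc.comp (hWc.comp Computable.fst))
  refine ⟨g, hgc, fun ε hε => ⟨fun ω hω => ?_, ?_⟩⟩
  · obtain ⟨x, hx, hωx⟩ := exists_rich_of_mem_richSet
      (mem_richSet_of_frequently (m := M (W ε)) (Nat.succ_pos _) hω)
    refine Set.mem_iUnion.2 ⟨Encodable.encode x, ?_⟩
    simpa [g, hx] using hωx
  · have hsub : (⋃ i, cyl (g (ε, i))) ⊆ richSet a b d w (M (W ε)) ∪ cyl (Y (W ε)) := by
      refine Set.iUnion_subset fun i ω hω => ?_
      by_cases h : Rich a b d w (M (W ε)) ((Encodable.decode (α := List Bool) i).getD [])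
      · simp only [g, h, decide_true, cond_true] at hω
        exact Or.inl (h.mem_richSet hω)
      · simp only [g, h, decide_false, cond_false] at hω
        exact Or.inr hω
    have hrich : μ.real (richSet a b d w (M (W ε))) ≤ d * μ.real (heavySet a b w (M (W ε))) := by
      have := ENNReal.toReal_mono (by finiteness) (measure_exists_rich_le herg.toMeasurePreserving
        (measurableSet_heavySet a b w (M (W ε))) d)
      rw [ENNReal.toReal_mul, ENNReal.toReal_natCast] at this
      exact this
    have hlt : μ.real (⋃ i, cyl (g (ε, i))) < ε := by
      have h1 := (measureReal_mono (μ := μ) hsub).trans (measureReal_union_le _ _)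
      have h2 := hMs (W ε)
      have h3 := hYs (W ε)
      set u := μ.real (heavySet a b w (M (W ε)))
      set v := μ.real (cyl (Y (W ε)))
      have hden : (0 : ℝ) < ε.den := by exact_mod_cast ε.den_pos
      have hnum : (1 : ℝ) ≤ ε * ε.den := by
        have : (1 : ℚ) ≤ ε * ε.den := by
          rw [Rat.mul_den_eq_num]
          exact_mod_cast Rat.num_pos.2 hε
        exact_mod_cast this
      have hWr : (W ε : ℝ) = (d + 2) * ε.den := by simp [hW]
      rw [hWr] at h2 h3
      have hu : 0 ≤ u := measureReal_nonneg
      have hv : 0 ≤ v := measureReal_nonneg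
      refine (h1.trans (add_le_add_left hrich v)).trans_lt ?_
      by_contra hcon
      push Not at hcon
      have h4 : 1 ≤ (d * u + v) * ε.den := hnum.trans (mul_le_mul_of_nonneg_right hcon hden.le)
      have hd : (0 : ℝ) ≤ d := by positivity
      nlinarith
    rw [← ENNReal.ofReal_toReal (measure_ne_top μ (⋃ i, cyl (g (ε, i))))]
    exact (ENNReal.ofReal_lt_ofReal_iff (by exact_mod_cast hε)).2 hlt

open Classical in
theorem MLRandom.eventually_count_le {μ : Measure (ℕ → Bool)} [IsProbabilityMeasure μ]
    (hcomp : ComputableMeasure μ) (herg : Ergodic shift μ) {ω : ℕ → Bool} (hω : MLRandom μ ω)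
    (w : List Bool) {c : ℝ} (hc : μ.real (cyl w) < c) :
    ∀ᶠ n : ℕ in atTop, (Nat.count (fun j => shift^[j] ω ∈ cyl w) n : ℝ) ≤ c * n := by
  obtain ⟨q, hq1, hq2⟩ := exists_rat_btwn hc
  obtain ⟨e, he⟩ := exists_nat_gt (2 / (c - q))
  have hq0 : 0 < q := by
    have := measureReal_nonneg (μ := μ) (s := cyl w)
    exact_mod_cast this.trans_lt hq1
  have hden : (0 : ℝ) < q.den := by exact_mod_cast q.den_pos
  have hqn : (q : ℝ) * q.den = q.num.toNat := by
    have h1 : q * q.den = q.num := Rat.mul_den_eq_num q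
    have h2 : (q.num.toNat : ℤ) = q.num := Int.toNat_of_nonneg (Rat.num_pos.2 hq0).le
    have h3 : q * q.den = (q.num.toNat : ℤ) := by rw [h1, h2]
    exact_mod_cast h3
  have h := hω _ (effNull_frequently_count hcomp herg (a := q.num.toNat) (b := q.den) e (w := w)
    (by rw [← hqn]; exact mul_lt_mul_of_pos_right hq1 hden))
  simp only [Set.mem_ofPred_eq, not_frequently, not_lt] at h
  rw [div_lt_iff₀ (by linarith)] at he
  filter_upwards [h] with n hn
  set C := Nat.count (fun j => shift^[j] ω ∈ cyl w) n
  have hn' : (q.den : ℝ) * e * C ≤ (q.num.toNat * e + 2 * q.den) * n := by exact_mod_cast hn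
  rw [← hqn] at hn'
  have he0 : (0 : ℝ) < e := by
    rcases Nat.eq_zero_or_pos e with rfl | h
    · simp at he; linarith
    · exact_mod_cast h
  have h5 : (e : ℝ) * C ≤ (q * e + 2) * n := by
    refine le_of_mul_le_mul_left ?_ hden
    linarith
  refine le_of_mul_le_mul_left (h5.trans ?_) he0
  have : (q * e + 2) * (n : ℝ) ≤ (e * (c - q) + q * e) * n :=
    mul_le_mul_of_nonneg_right (by linarith) (by positivity)
  linarith

end RandomFrequencies

section Generic

/-- The window of length `L` of `ω` at position `j`. -/
def window (ω : ℕ → Bool) (L j : ℕ) : Fin L → Bool := fun i => ω (j + i)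

/-- The probability of the cylinder of a word given as a function on `Fin L`. -/
noncomputable def cylProb (μ : Measure (ℕ → Bool)) {L : ℕ} (v : Fin L → Bool) : ℝ :=
  (μ (cyl (List.ofFn v))).toReal

/-- All statistics of finite windows along `ω` converge to their expectations under `μ`. -/
def Generic (μ : Measure (ℕ → Bool)) (ω : ℕ → Bool) : Prop :=
  ∀ (L : ℕ) (g : (Fin L → Bool) → ℝ),
    Tendsto (fun n : ℕ => (∑ j ∈ Finset.range n, g (window ω L j)) / n) atTop
      (nhds (∑ v, cylProb μ v * g v))

theorem iterate_shift_mem_cyl_ofFn {ω : ℕ → Bool} {L j : ℕ} {v : Fin L → Bool} :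
    shift^[j] ω ∈ cyl (List.ofFn v) ↔ window ω L j = v := by
  rw [mem_cyl_iff_pre_eq, List.length_ofFn, pre, List.ofFn_inj]
  simp_rw [iterate_shift_apply]
  rfl

theorem cylProb_nonneg (μ : Measure (ℕ → Bool)) {L : ℕ} (v : Fin L → Bool) : 0 ≤ cylProb μ v :=
  ENNReal.toReal_nonneg

theorem sum_cylProb (μ : Measure (ℕ → Bool)) [IsProbabilityMeasure μ] (L : ℕ) :
    ∑ v : Fin L → Bool, cylProb μ v = 1 := by
  have h : ∀ v : Fin L → Bool, cyl (List.ofFn v) = (fun ω => window ω L 0) ⁻¹' {v} := by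
    intro v
    ext ω
    exact iterate_shift_mem_cyl_ofFn (j := 0)
  simp only [cylProb]
  rw [← ENNReal.toReal_sum fun v _ => measure_ne_top _ _]
  simp_rw [h]
  rw [sum_measure_preimage_singleton]
  · simp
  · intro v _
    rw [← h]
    exact measurableSet_cyl _

theorem tendsto_of_eventually_le_of_sum_eq {ι : Type*} [Fintype ι] [DecidableEq ι]
    {f : ι → ℕ → ℝ} {p : ι → ℝ}
    (hf : ∀ᶠ n in atTop, ∑ i, f i n = ∑ i, p i)
    (hle : ∀ i, ∀ c, p i < c → ∀ᶠ n in atTop, f i n ≤ c) (i : ι) :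
    Tendsto (f i) atTop (nhds (p i)) := by
  rw [Metric.tendsto_atTop']
  intro ε hε
  set δ := ε / (Fintype.card ι + 1)
  have hc : (0 : ℝ) < Fintype.card ι + 1 := by positivity
  have hδ : 0 < δ := div_pos hε hc
  have hδ' : Fintype.card ι * δ < ε := by
    rw [← mul_div_assoc, div_lt_iff₀ hc]
    nlinarith
  have hall : ∀ᶠ n in atTop, ∀ k, f k n ≤ p k + δ :=
    eventually_all.2 fun k => hle k _ (by linarith)
  obtain ⟨n₀, h₀⟩ := eventually_atTop.1 (hf.and hall)
  refine ⟨n₀, fun n hn => ?_⟩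
  obtain ⟨h1, h2⟩ := h₀ n hn.le
  have hcard : (1 : ℝ) ≤ Fintype.card ι := by
    exact_mod_cast Fintype.card_pos_iff.2 ⟨i⟩
  rw [Real.dist_eq, abs_lt]
  constructor
  · rw [← Finset.add_sum_erase _ _ (Finset.mem_univ i),
      ← Finset.add_sum_erase (a := i) _ p (Finset.mem_univ i)] at h1
    have h3 : ∑ k ∈ Finset.univ.erase i, f k n ≤ ∑ k ∈ Finset.univ.erase i, (p k + δ) :=
      Finset.sum_le_sum fun k _ => h2 k
    rw [Finset.sum_add_distrib, Finset.sum_const, Finset.card_erase_of_mem (Finset.mem_univ _),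
      Finset.card_univ, nsmul_eq_mul] at h3
    have h4 : ((Fintype.card ι - 1 : ℕ) : ℝ) * δ ≤ Fintype.card ι * δ :=
      mul_le_mul_of_nonneg_right (by exact_mod_cast Nat.sub_le _ _) hδ.le
    linarith
  · have := h2 i
    nlinarith

theorem MLRandom.generic {μ : Measure (ℕ → Bool)} [IsProbabilityMeasure μ]
    (hcomp : ComputableMeasure μ) (herg : Ergodic shift μ) {ω : ℕ → Bool} (hω : MLRandom μ ω) :
    Generic μ ω := by
  classical
  intro L g
  set C : (Fin L → Bool) → ℕ → ℕ := fun v n => Nat.count (fun j => window ω L j = v) n with hC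
  have hCs : ∀ v n, (C v n : ℝ) = ∑ j ∈ Finset.range n, if window ω L j = v then 1 else 0 := by
    intro v n
    simp only [hC, Nat.count_eq_card_filter_range, Finset.card_filter]
    push_cast
    rfl
  have hfreq : ∀ v, Tendsto (fun n => (C v n : ℝ) / n) atTop (nhds (cylProb μ v)) := by
    refine tendsto_of_eventually_le_of_sum_eq (f := fun v n => (C v n : ℝ) / n) ?_ ?_
    · filter_upwards [eventually_gt_atTop 0] with n hn
      rw [sum_cylProb, ← Finset.sum_div]
      simp_rw [hCs]
      rw [Finset.sum_comm]
      simp only [Finset.sum_ite_eq, Finset.mem_univ, if_true, Finset.sum_const, Finset.card_range,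
        nsmul_eq_mul, mul_one]
      exact div_self (by exact_mod_cast hn.ne')
    · intro v c hc
      filter_upwards [hω.eventually_count_le hcomp herg (List.ofFn v) hc, eventually_gt_atTop 0]
        with n hn hn0
      rw [div_le_iff₀ (by exact_mod_cast hn0)]
      refine le_trans ?_ hn
      exact_mod_cast Nat.count_le_count_of_imp fun j _ hj => iterate_shift_mem_cyl_ofFn.2 hj
  have hlim := tendsto_finsetSum Finset.univ fun v (_ : v ∈ Finset.univ) =>
    (hfreq v).mul_const (g v)
  refine hlim.congr fun n => ?_
  simp_rw [hCs, div_mul_eq_mul_div]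
  rw [← Finset.sum_div]
  congr 1
  simp_rw [Finset.sum_mul]
  rw [Finset.sum_comm]
  simp

end Generic

section WordSums

/-- The finite set of binary words of length `n`. -/
noncomputable def wordSet (n : ℕ) : Finset (List Bool) := (List.finite_length_eq Bool n).toFinset

theorem mem_wordSet {n : ℕ} {x : List Bool} : x ∈ wordSet n ↔ x.length = n := by
  simp [wordSet]

theorem wordSet_zero : wordSet 0 = {[]} := by
  ext x; simp [mem_wordSet]

theorem sum_ofFn_eq_sum_wordSet (n : ℕ) (f : List Bool → ℝ) :
    ∑ v : Fin n → Bool, f (List.ofFn v) = ∑ x ∈ wordSet n, f x := by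
  refine Finset.sum_bij (fun v _ => List.ofFn v) (fun v _ => by simp [mem_wordSet])
    (fun v _ v' _ h => List.ofFn_injective h) (fun x hx => ?_) fun _ _ => rfl
  obtain rfl := mem_wordSet.1 hx
  exact ⟨fun i => x.get i, Finset.mem_univ _, List.ofFn_get x⟩

theorem sum_wordSet_add (a b : ℕ) (f : List Bool → ℝ) :
    ∑ x ∈ wordSet (a + b), f x = ∑ u ∈ wordSet a, ∑ v ∈ wordSet b, f (u ++ v) := by
  rw [← Finset.sum_product']
  refine (Finset.sum_bij (fun p _ => p.1 ++ p.2) ?_ ?_ ?_ fun _ _ => rfl).symm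
  · rintro ⟨u, v⟩ h
    simp only [Finset.mem_product, mem_wordSet] at h
    simp [mem_wordSet, h]
  · rintro ⟨u, v⟩ h ⟨u', v'⟩ h' heq
    simp only [Finset.mem_product, mem_wordSet] at h h'
    have := List.append_inj heq (h.1.trans h'.1.symm)
    exact Prod.ext this.1 this.2
  · intro x hx
    rw [mem_wordSet] at hx
    refine ⟨(x.take a, x.drop a), ?_, List.take_append_drop a x⟩
    simp only [Finset.mem_product, mem_wordSet, List.length_take, List.length_drop]
    omega

theorem sum_wordSet_succ (n : ℕ) (f : List Bool → ℝ) :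
    ∑ x ∈ wordSet (n + 1), f x =
      ∑ v ∈ wordSet n, f (false :: v) + ∑ v ∈ wordSet n, f (true :: v) := by
  rw [add_comm n, sum_wordSet_add]
  have : wordSet 1 = {[false], [true]} := by
    ext x
    rw [mem_wordSet, List.length_eq_one_iff]
    simp
  rw [this, Finset.sum_pair (by simp)]
  simp

end WordSums

section Parsing

/-- Length of the next phrase in the LZ78 parsing, minus one. -/
def lzNext (rest : List Bool) (seen : List (List Bool)) : ℕ :=
  (((List.range rest.length).filter
    (fun jj => decide (rest.take (jj + 1) ∉ seen))).head?).getD (rest.length - 1)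

theorem lzCountAux_nil (fuel : ℕ) (seen : List (List Bool)) : lzCountAux fuel [] seen = 0 := by
  cases fuel <;> simp [lzCountAux]

theorem lzCountAux_succ (fuel : ℕ) {rest : List Bool} (h : rest ≠ []) (seen : List (List Bool)) :
    lzCountAux (fuel + 1) rest seen = 1 + lzCountAux fuel (rest.drop (lzNext rest seen + 1))
      (rest.take (lzNext rest seen + 1) :: seen) := by
  rw [lzCountAux, if_neg h]
  rfl

theorem lzNext_spec {rest : List Bool} (h : rest ≠ []) (seen : List (List Bool)) :
    lzNext rest seen < rest.length ∧
      (rest.take (lzNext rest seen + 1) ∉ seen ∨ lzNext rest seen + 1 = rest.length) ∧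
      ∀ i < lzNext rest seen, rest.take (i + 1) ∈ seen := by
  have hlen : 0 < rest.length := List.length_pos_iff.2 h
  have hfind : ((List.range rest.length).filter
        (fun jj => decide (rest.take (jj + 1) ∉ seen))).head?
      = (List.range rest.length).find? fun jj => decide (rest.take (jj + 1) ∉ seen) := by
    rw [List.head?_filter]
  rw [lzNext, hfind]
  rcases hf : (List.range rest.length).find? fun jj => decide (rest.take (jj + 1) ∉ seen) with _ | j
  · rw [List.find?_eq_none] at hf
    simp only [Option.getD_none]
    refine ⟨by omega, Or.inr (by omega), fun i hi => ?_⟩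
    simpa using hf i (List.mem_range.2 (by omega))
  · rw [List.find?_range_eq_some] at hf
    simp only [Option.getD_some]
    obtain ⟨h1, h2, h3⟩ := hf
    refine ⟨by simpa using h2, Or.inl (by simpa using h1), fun i hi => ?_⟩
    simpa using h3 i hi

/-- Code length of the part `rest` of a word whose earlier phrases are `seen`. -/
def lzAuxLen (fuel : ℕ) (rest : List Bool) (seen : List (List Bool)) : ℕ :=
  ∑ k ∈ Finset.range (lzCountAux fuel rest seen), (Nat.clog 2 (seen.length + k + 1) + 1)

theorem lzLen_eq_lzAuxLen (x : List Bool) : lzLen x = lzAuxLen x.length x [] := by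
  simp [lzLen, lzAuxLen, lzCount]

theorem lzAuxLen_succ (fuel : ℕ) {rest : List Bool} (h : rest ≠ []) (seen : List (List Bool)) :
    lzAuxLen (fuel + 1) rest seen = (Nat.clog 2 (seen.length + 1) + 1) +
      lzAuxLen fuel (rest.drop (lzNext rest seen + 1))
        (rest.take (lzNext rest seen + 1) :: seen) := by
  rw [lzAuxLen, lzCountAux_succ fuel h, add_comm 1, Finset.sum_range_succ', lzAuxLen, add_comm]
  congr 1
  refine Finset.sum_congr rfl fun k _ => ?_
  rw [List.length_cons]
  congr 2
  omega

/-- The possible next phrases: a previous phrase or the empty word, extended by one letter. -/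
def nextPhrases (seen : List (List Bool)) : Finset (List Bool) :=
  ((([] :: seen).map fun p => p ++ [false]) ++ (([] :: seen).map fun p => p ++ [true])).toFinset

theorem card_nextPhrases_le (seen : List (List Bool)) :
    (nextPhrases seen).card ≤ 2 * (seen.length + 1) := by
  refine (List.toFinset_card_le _).trans ?_
  simp
  omega

theorem take_lzNext_mem_nextPhrases {rest : List Bool} (h : rest ≠ []) (seen : List (List Bool)) :
    rest.take (lzNext rest seen + 1) ∈ nextPhrases seen := by
  obtain ⟨h1, -, h3⟩ := lzNext_spec h seen
  set j := lzNext rest seen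
  have hp : rest.take j ∈ [] :: seen := by
    rcases Nat.eq_zero_or_pos j with hj | hj
    · simp [hj]
    · have := h3 (j - 1) (by omega)
      rw [Nat.sub_add_cancel hj] at this
      exact List.mem_cons_of_mem _ this
  rw [List.take_add_one, List.getElem?_eq_getElem h1]
  simp only [nextPhrases, List.mem_toFinset, List.mem_append, List.mem_map, Option.toList_some]
  cases rest[j]
  · exact Or.inl ⟨_, hp, rfl⟩
  · exact Or.inr ⟨_, hp, rfl⟩

theorem nextPhrase_weight_le (k : ℕ) :
    (2 * (k + 1) : ℝ) * (1 / 2) ^ (Nat.clog 2 (k + 1) + 1) ≤ 1 := by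
  have h : (k + 1 : ℝ) ≤ 2 ^ Nat.clog 2 (k + 1) := by
    exact_mod_cast Nat.le_pow_clog (by norm_num) (k + 1)
  rw [one_div, inv_pow, ← div_eq_mul_inv, div_le_one (by positivity), pow_succ]
  linarith

/-- **Kraft inequality** for the LZ78 code lengths. -/
theorem sum_lzAuxLen_le_one (fuel n : ℕ) (hn : n ≤ fuel) (seen : List (List Bool)) :
    ∑ x ∈ wordSet n, (1 / 2 : ℝ) ^ lzAuxLen fuel x seen ≤ 1 := by
  induction fuel generalizing n seen with
  | zero =>
    obtain rfl : n = 0 := by omega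
    simp [wordSet_zero, lzAuxLen, lzCountAux_nil]
  | succ fuel ih =>
    rcases Nat.eq_zero_or_pos n with rfl | hn0
    · simp [wordSet_zero, lzAuxLen, lzCountAux_nil]
    have hne : ∀ x ∈ wordSet n, x ≠ [] := by
      intro x hx
      rw [mem_wordSet] at hx
      exact List.length_pos_iff.1 (by omega)
    rw [← Finset.sum_fiberwise_of_maps_to
      fun x hx => take_lzNext_mem_nextPhrases (hne x hx) seen]
    set c := Nat.clog 2 (seen.length + 1) + 1 with hc
    have hfib : ∀ f ∈ nextPhrases seen, ∑ x ∈ (wordSet n).filter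
        (fun x => x.take (lzNext x seen + 1) = f), (1 / 2 : ℝ) ^ lzAuxLen (fuel + 1) x seen ≤
          (1 / 2) ^ c := by
      intro f _
      set s := (wordSet n).filter (fun x => x.take (lzNext x seen + 1) = f)
      have hs : ∀ x ∈ s, f.length = lzNext x seen + 1 ∧ x.take f.length = f ∧ x.length = n ∧
          x ≠ [] := by
        intro x hx
        rw [Finset.mem_filter] at hx
        have h1 := (lzNext_spec (hne x hx.1) seen).1
        have h2 := congrArg List.length hx.2
        rw [List.length_take, min_eq_left (by omega)] at h2
        exact ⟨h2.symm, by rw [← h2]; exact hx.2, mem_wordSet.1 hx.1, hne x hx.1⟩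
      have hinj : Set.InjOn (fun x : List Bool => x.drop f.length) s := by
        intro x hx y hy hxy
        rw [← List.take_append_drop f.length x, ← List.take_append_drop f.length y,
          (hs x hx).2.1, (hs y hy).2.1]
        exact congrArg _ hxy
      calc ∑ x ∈ s, (1 / 2 : ℝ) ^ lzAuxLen (fuel + 1) x seen
          = ∑ x ∈ s, (1 / 2 : ℝ) ^ c *
              (1 / 2 : ℝ) ^ lzAuxLen fuel (x.drop f.length) (f :: seen) := by
            refine Finset.sum_congr rfl fun x hx => ?_
            obtain ⟨h1, h2, -, h4⟩ := hs x hx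
            rw [lzAuxLen_succ fuel h4, ← h1, h2, pow_add]
        _ = (1 / 2 : ℝ) ^ c * ∑ y ∈ s.image (fun x => x.drop f.length),
              (1 / 2 : ℝ) ^ lzAuxLen fuel y (f :: seen) := by
            rw [← Finset.mul_sum, Finset.sum_image hinj]
        _ ≤ (1 / 2 : ℝ) ^ c * 1 := by
            refine mul_le_mul_of_nonneg_left ?_ (by positivity)
            rcases s.eq_empty_or_nonempty with h0 | ⟨x₀, hx₀⟩
            · simp [h0]
            refine le_trans (Finset.sum_le_sum_of_subset_of_nonneg ?_ fun _ _ _ => by positivity)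
              (ih (n - f.length) ?_ (f :: seen))
            · intro y hy
              obtain ⟨x, hx, rfl⟩ := Finset.mem_image.1 hy
              rw [mem_wordSet, List.length_drop, (hs x hx).2.2.1]
            · have := (hs x₀ hx₀).1
              omega
        _ = _ := mul_one _
    refine (Finset.sum_le_sum hfib).trans ?_
    rw [Finset.sum_const, nsmul_eq_mul]
    refine le_trans (mul_le_mul_of_nonneg_right ?_ (by positivity))
      (nextPhrase_weight_le seen.length)
    exact_mod_cast card_nextPhrases_le seen

theorem sum_lzLen_le_one (n : ℕ) : ∑ x ∈ wordSet n, (1 / 2 : ℝ) ^ lzLen x ≤ 1 := by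
  refine le_of_eq_of_le (Finset.sum_congr rfl fun x hx => ?_) (sum_lzAuxLen_le_one n n le_rfl [])
  rw [lzLen_eq_lzAuxLen, mem_wordSet.1 hx]

end Parsing

section LowerBound

theorem sum_wordSet_half_pow (r : ℕ) : ∑ _x ∈ wordSet r, (1 / 2 : ℝ) ^ r = 1 := by
  rw [← sum_ofFn_eq_sum_wordSet r fun _ => (1 / 2 : ℝ) ^ r]
  simp

/-- Kraft inequality for the code which encodes `M` blocks of length `N` by LZ78 and copies the
remaining `r` letters. -/
theorem sum_blocks_le_one (M N r : ℕ) :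
    ∑ x ∈ wordSet (M * N + r),
      (1 / 2 : ℝ) ^ (r + ∑ i ∈ Finset.range M, lzLen ((x.drop (i * N)).take N)) ≤ 1 := by
  induction M with
  | zero => simpa using (sum_wordSet_half_pow r).le
  | succ M ih =>
    rw [show (M + 1) * N + r = N + (M * N + r) by ring, sum_wordSet_add]
    have h : ∀ u ∈ wordSet N, ∀ v, (1 / 2 : ℝ) ^ (r + ∑ i ∈ Finset.range (M + 1),
        lzLen (((u ++ v).drop (i * N)).take N)) = (1 / 2) ^ lzLen u *
          (1 / 2) ^ (r + ∑ i ∈ Finset.range M, lzLen ((v.drop (i * N)).take N)) := by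
      intro u hu v
      rw [mem_wordSet] at hu
      rw [← pow_add, Finset.sum_range_succ']
      congr 1
      have h1 : ∀ i, (u ++ v).drop ((i + 1) * N) = v.drop (i * N) := by
        intro i
        rw [show (i + 1) * N = u.length + i * N by rw [hu]; ring, List.drop_length_add_append]
      simp_rw [h1]
      rw [zero_mul, List.drop_zero, ← hu, List.take_left]
      ring
    calc _ = ∑ u ∈ wordSet N, (1 / 2 : ℝ) ^ lzLen u * ∑ v ∈ wordSet (M * N + r),
          (1 / 2 : ℝ) ^ (r + ∑ i ∈ Finset.range M, lzLen ((v.drop (i * N)).take N)) := by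
          refine Finset.sum_congr rfl fun u hu => ?_
          rw [Finset.mul_sum]
          exact Finset.sum_congr rfl fun v _ => h u hu v
      _ ≤ ∑ u ∈ wordSet N, (1 / 2 : ℝ) ^ lzLen u * 1 :=
          Finset.sum_le_sum fun u _ => mul_le_mul_of_nonneg_left ih (by positivity)
      _ ≤ 1 := by simpa using sum_lzLen_le_one N

/-- Length of the code which copies the first `o` letters, encodes `M` blocks of length `N` by
LZ78, and copies the remaining `N - o` letters. -/
def offsetLen (M N o : ℕ) (x : List Bool) : ℕ :=
  N + ∑ i ∈ Finset.range M, lzLen ((x.drop (o + i * N)).take N)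

theorem sum_offsetLen_le_one (M : ℕ) {N o : ℕ} (ho : o ≤ N) :
    ∑ x ∈ wordSet ((M + 1) * N), (1 / 2 : ℝ) ^ offsetLen M N o x ≤ 1 := by
  obtain ⟨r, rfl⟩ := Nat.exists_eq_add_of_le ho
  rw [show (M + 1) * (o + r) = o + (M * (o + r) + r) by ring, sum_wordSet_add]
  have h : ∀ u ∈ wordSet o, ∀ v, (1 / 2 : ℝ) ^ offsetLen M (o + r) o (u ++ v) = (1 / 2) ^ o *
      (1 / 2) ^ (r + ∑ i ∈ Finset.range M, lzLen ((v.drop (i * (o + r))).take (o + r))) := by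
    intro u hu v
    rw [mem_wordSet] at hu
    rw [← pow_add, offsetLen, add_assoc]
    have h1 : ∀ i, (u ++ v).drop (o + i * (o + r)) = v.drop (i * (o + r)) := by
      intro i
      rw [← hu, List.drop_length_add_append]
    simp_rw [h1]
  calc _ = ∑ u ∈ wordSet o, (1 / 2 : ℝ) ^ o * ∑ v ∈ wordSet (M * (o + r) + r),
        (1 / 2 : ℝ) ^ (r + ∑ i ∈ Finset.range M,
          lzLen ((v.drop (i * (o + r))).take (o + r))) := by
        refine Finset.sum_congr rfl fun u hu => ?_
        rw [Finset.mul_sum]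
        exact Finset.sum_congr rfl fun v _ => h u hu v
    _ ≤ ∑ u ∈ wordSet o, (1 / 2 : ℝ) ^ o * 1 :=
        Finset.sum_le_sum fun u _ => mul_le_mul_of_nonneg_left (sum_blocks_le_one M _ r)
          (by positivity)
    _ = 1 := by simpa using sum_wordSet_half_pow o

/-- **Gibbs' inequality**. -/
theorem sum_negMulLog_le {ι : Type*} [Fintype ι] {p q : ι → ℝ} (hp : ∀ i, 0 ≤ p i)
    (hp1 : ∑ i, p i = 1) (hq : ∀ i, 0 < q i) (hq1 : ∑ i, q i ≤ 1) :
    ∑ i, Real.negMulLog (p i) ≤ ∑ i, p i * -Real.log (q i) := by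
  have h : ∀ i, Real.negMulLog (p i) ≤ p i * -Real.log (q i) + (q i - p i) := by
    intro i
    rcases (hp i).eq_or_lt with h0 | h0
    · simp [← h0, (hq i).le]
    · have h1 := Real.log_le_sub_one_of_pos (div_pos (hq i) h0)
      rw [Real.log_div (hq i).ne' h0.ne'] at h1
      have h2 := mul_le_mul_of_nonneg_left h1 h0.le
      have h3 : p i * (q i / p i - 1) = q i - p i := by field_simp
      rw [Real.negMulLog]
      linarith
  refine (Finset.sum_le_sum fun i _ => h i).trans ?_
  rw [Finset.sum_add_distrib, Finset.sum_sub_distrib, hp1]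
  linarith

/-- Entropy of the distribution of words of length `n`, in nats. -/
noncomputable def blockEntropy (μ : Measure (ℕ → Bool)) (n : ℕ) : ℝ :=
  ∑ v : Fin n → Bool, Real.negMulLog (cylProb μ v)

theorem blockEntropy_zero (μ : Measure (ℕ → Bool)) [IsProbabilityMeasure μ] :
    blockEntropy μ 0 = 0 := by
  simp [blockEntropy, cylProb, cyl]

theorem blockEntropy_eq (μ : Measure (ℕ → Bool)) [IsProbabilityMeasure μ] (n : ℕ) :
    blockEntropy μ n = n * (entropyAt μ n * Real.log 2) := by
  rcases Nat.eq_zero_or_pos n with rfl | hn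
  · simp [blockEntropy_zero]
  have h2 : Real.log 2 ≠ 0 := (Real.log_pos (by norm_num)).ne'
  have hn' : (n : ℝ) ≠ 0 := by exact_mod_cast hn.ne'
  rw [entropyAt, mul_assoc, Finset.sum_mul, ← mul_assoc, mul_one_div_cancel hn', one_mul,
    blockEntropy]
  refine Finset.sum_congr rfl fun v _ => ?_
  rw [Real.negMulLog, Real.logb, cylProb]
  field_simp

theorem ofFn_window (ω : ℕ → Bool) (L j : ℕ) : List.ofFn (window ω L j) = pre (shift^[j] ω) L := by
  rw [pre, List.ofFn_inj]
  funext i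
  rw [iterate_shift_apply, window]

theorem take_drop_ofFn_window (ω : ℕ → Bool) {L N j k : ℕ} (h : k + N ≤ L) :
    ((List.ofFn (window ω L j)).drop k).take N = List.ofFn (window ω N (j + k)) := by
  rw [ofFn_window, ofFn_window, drop_pre, take_pre, min_eq_left (by omega),
    ← Function.iterate_add_apply, add_comm k]

theorem offsetLen_window (ω : ℕ → Bool) (M a : ℕ) {N t : ℕ} (ht : t < N) :
    offsetLen M N (N - t) (List.ofFn (window ω ((M + 1) * N) (a * N + t))) =
      N + ∑ i ∈ Finset.range M, lzLen (List.ofFn (window ω N ((a + 1 + i) * N))) := by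
  rw [offsetLen]
  congr 1
  refine Finset.sum_congr rfl fun i hi => ?_
  rw [Finset.mem_range] at hi
  have h1 : (i + 1) * N ≤ M * N := Nat.mul_le_mul_right N hi
  rw [take_drop_ofFn_window ω (by rw [add_mul] at h1; rw [add_mul]; omega)]
  congr 3
  rw [add_mul, add_mul]
  omega

theorem sum_range_mul {M : Type*} [AddCommMonoid M] (f : ℕ → M) (A N : ℕ) :
    ∑ j ∈ Finset.range (A * N), f j =
      ∑ a ∈ Finset.range A, ∑ t ∈ Finset.range N, f (a * N + t) := by
  induction A with
  | zero => simp
  | succ A ih => rw [add_mul, one_mul, Finset.sum_range_add, ih, Finset.sum_range_succ]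

/-- The mixture over all phases `t < N` of the codes `offsetLen M N (N - t)`. -/
noncomputable def phaseMixture (M N : ℕ) (x : List Bool) : ℝ :=
  (∑ t ∈ Finset.range N, (1 / 2 : ℝ) ^ offsetLen M N (N - t) x) / N

theorem phaseMixture_pos (M : ℕ) {N : ℕ} (hN : 0 < N) (x : List Bool) :
    0 < phaseMixture M N x :=
  div_pos (Finset.sum_pos (fun _ _ => by positivity) ⟨0, Finset.mem_range.2 hN⟩)
    (by exact_mod_cast hN)

theorem sum_phaseMixture_le_one (M : ℕ) {N : ℕ} (hN : 0 < N) :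
    ∑ x ∈ wordSet ((M + 1) * N), phaseMixture M N x ≤ 1 := by
  have hN' : (0 : ℝ) < N := by exact_mod_cast hN
  simp only [phaseMixture]
  rw [← Finset.sum_div, div_le_one hN', Finset.sum_comm]
  refine (Finset.sum_le_sum fun t _ => sum_offsetLen_le_one M (Nat.sub_le N t)).trans ?_
  simp

theorem neg_log_phaseMixture_le (M : ℕ) {N t : ℕ} (ht : t < N) (x : List Bool) :
    -Real.log (phaseMixture M N x) ≤ Real.log N + offsetLen M N (N - t) x * Real.log 2 := by
  have hN' : (0 : ℝ) < N := by exact_mod_cast (Nat.zero_le t).trans_lt ht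
  have h : (1 / 2 : ℝ) ^ offsetLen M N (N - t) x / N ≤ phaseMixture M N x := by
    refine div_le_div_of_nonneg_right ?_ hN'.le
    exact Finset.single_le_sum (f := fun t => (1 / 2 : ℝ) ^ offsetLen M N (N - t) x)
      (fun _ _ => by positivity) (Finset.mem_range.2 ht)
  have h2 := Real.log_le_log (by positivity) h
  rw [Real.log_div (by positivity) hN'.ne', Real.log_pow, one_div, Real.log_inv] at h2
  linarith

theorem Generic.blockEntropy_le {μ : Measure (ℕ → Bool)} [IsProbabilityMeasure μ] {ω : ℕ → Bool}
    (hω : Generic μ ω) {N : ℕ} (hN : 0 < N) {c : ℝ} (hc : ∀ᶠ B : ℕ in atTop,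
      (∑ a ∈ Finset.range B, (lzLen (List.ofFn (window ω N (a * N))) : ℝ)) ≤ c * (N * B)) (M : ℕ) :
    blockEntropy μ ((M + 1) * N) ≤ Real.log N + (N + M * N * c) * Real.log 2 := by
  have hN' : (0 : ℝ) < N := by exact_mod_cast hN
  set G : (Fin ((M + 1) * N) → Bool) → ℝ := fun v => -Real.log (phaseMixture M N (List.ofFn v))
    with hG
  set lam : ℕ → ℝ := fun a => (lzLen (List.ofFn (window ω N (a * N))) : ℝ) with hlam
  have hlam0 : ∀ a, 0 ≤ lam a := fun a => by positivity
  have hgibbs : blockEntropy μ ((M + 1) * N) ≤ ∑ v, cylProb μ v * G v := by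
    refine sum_negMulLog_le (cylProb_nonneg μ) (sum_cylProb μ _)
      (fun v => phaseMixture_pos M hN _) ?_
    rw [sum_ofFn_eq_sum_wordSet _ (phaseMixture M N)]
    exact sum_phaseMixture_le_one M hN
  refine hgibbs.trans ?_
  have hsum : ∀ A : ℕ, ∑ j ∈ Finset.range (A * N), G (window ω _ j) ≤
      A * N * (Real.log N + N * Real.log 2) +
        N * M * (∑ a ∈ Finset.range (A + M), lam a) * Real.log 2 := by
    intro A
    rw [sum_range_mul]
    have h1 : ∀ a ∈ Finset.range A, ∑ t ∈ Finset.range N, G (window ω ((M + 1) * N) (a * N + t)) ≤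
        N * (Real.log N + N * Real.log 2) +
          N * Real.log 2 * ∑ i ∈ Finset.range M, lam (a + 1 + i) := by
      intro a _
      have h2 : ∀ t ∈ Finset.range N, G (window ω ((M + 1) * N) (a * N + t)) ≤
          Real.log N + (N + ∑ i ∈ Finset.range M, lam (a + 1 + i)) * Real.log 2 := by
        intro t ht
        rw [Finset.mem_range] at ht
        have := neg_log_phaseMixture_le M ht (List.ofFn (window ω ((M + 1) * N) (a * N + t)))
        rw [offsetLen_window ω M a ht] at this
        push_cast at this
        exact this
      refine (Finset.sum_le_sum h2).trans (le_of_eq ?_)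
      rw [Finset.sum_const, Finset.card_range, nsmul_eq_mul]
      ring
    refine (Finset.sum_le_sum h1).trans ?_
    rw [Finset.sum_add_distrib, Finset.sum_const, Finset.card_range, nsmul_eq_mul,
      ← Finset.mul_sum, Finset.sum_comm]
    have h3 : ∀ i ∈ Finset.range M, ∑ a ∈ Finset.range A, lam (a + 1 + i) ≤
        ∑ a ∈ Finset.range (A + M), lam a := by
      intro i hi
      rw [Finset.mem_range] at hi
      rw [← Finset.sum_image (f := lam) (g := fun a => a + 1 + i) (s := Finset.range A)
        (fun a _ b _ h => by simpa using h)]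
      refine Finset.sum_le_sum_of_subset_of_nonneg ?_ fun _ _ _ => hlam0 _
      intro b hb
      simp only [Finset.mem_image, Finset.mem_range] at hb ⊢
      obtain ⟨a, ha, rfl⟩ := hb
      omega
    have h4 := Finset.sum_le_sum h3
    rw [Finset.sum_const, Finset.card_range, nsmul_eq_mul] at h4
    have h5 : (0 : ℝ) ≤ N * Real.log 2 := by positivity
    have h6 := mul_le_mul_of_nonneg_left h4 h5
    nlinarith
  have htend : Tendsto (fun A : ℕ => (∑ j ∈ Finset.range (A * N), G (window ω _ j)) /
      ((A * N : ℕ) : ℝ)) atTop (nhds (∑ v, cylProb μ v * G v)) :=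
    (hω _ G).comp (tendsto_id.atTop_mul_const' hN)
  have hlim : Tendsto (fun A : ℕ => Real.log N + N * Real.log 2 +
      M * N * c * Real.log 2 * (1 + M * (A : ℝ)⁻¹)) atTop
      (nhds (Real.log N + N * Real.log 2 + M * N * c * Real.log 2 * (1 + M * 0))) :=
    ((((tendsto_inv_atTop_nhds_zero_nat (𝕜 := ℝ)).const_mul (M : ℝ)).const_add 1).const_mul
      _).const_add _
  have hle := le_of_tendsto_of_tendsto htend hlim ?_
  · linarith
  · have hc' := (tendsto_add_atTop_nat M).eventually hc
    filter_upwards [hc', eventually_gt_atTop 0] with A hA hA0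
    have hA' : (0 : ℝ) < A := by exact_mod_cast hA0
    push_cast at hA ⊢
    rw [div_le_iff₀ (by positivity)]
    refine (hsum A).trans ?_
    have h7 : (N : ℝ) * M * (∑ a ∈ Finset.range (A + M), lam a) * Real.log 2 ≤
        N * M * (c * (N * (A + M))) * Real.log 2 := by
      have : 0 ≤ Real.log 2 := by positivity
      gcongr
    have h8 : M * N * c * Real.log 2 * (1 + M * (A : ℝ)⁻¹) * (A * N) =
        N * M * (c * (N * (A + M))) * Real.log 2 := by
      field_simp
    nlinarith

theorem Generic.entropy_le {μ : Measure (ℕ → Bool)} [IsProbabilityMeasure μ] {ω : ℕ → Bool}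
    (hω : Generic μ ω) {H : ℝ} (hH : HasEntropy μ H) {N : ℕ} (hN : 0 < N) {c : ℝ}
    (hc : ∀ᶠ B : ℕ in atTop,
      (∑ a ∈ Finset.range B, (lzLen (List.ofFn (window ω N (a * N))) : ℝ)) ≤ c * (N * B)) :
    H ≤ c := by
  have hN' : (0 : ℝ) < N := by exact_mod_cast hN
  have h2 : 0 < Real.log 2 := Real.log_pos (by norm_num)
  have h : ∀ M : ℕ, entropyAt μ ((M + 1) * N) ≤
      ((Real.log N / Real.log 2 / N + 1) - c) * (1 / ((M : ℝ) + 1)) + c := by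
    intro M
    have h1 := hω.blockEntropy_le hN hc M
    rw [blockEntropy_eq] at h1
    push_cast at h1
    have h3 : (0 : ℝ) < M + 1 := by positivity
    rw [← mul_le_mul_iff_right₀ (show 0 < ((M : ℝ) + 1) * N * Real.log 2 by positivity)]
    have h4 : ((M : ℝ) + 1) * N * Real.log 2 * (((Real.log N / Real.log 2 / N + 1) - c) *
        (1 / ((M : ℝ) + 1)) + c) = Real.log N + (N + M * N * c) * Real.log 2 := by
      field_simp
      ring
    rw [h4]
    linarith
  have hl : Tendsto (fun M : ℕ => entropyAt μ ((M + 1) * N)) atTop (nhds H) :=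
    hH.comp ((tendsto_add_atTop_nat 1).atTop_mul_const' hN)
  have hr := ((tendsto_one_div_add_atTop_nhds_zero_nat (𝕜 := ℝ)).const_mul
    (Real.log N / Real.log 2 / N + 1 - c)).add_const c
  rw [mul_zero, zero_add] at hr
  exact le_of_tendsto_of_tendsto' hl hr h

end LowerBound

section FiniteStateModels

variable {S : Type*}

/-- Weight assigned to a word by a finite-state model with transition function `step` and letter
weights `q`, started in the state `s`. -/
def modelWeight (step : S → Bool → S) (q : S → Bool → ℝ) : S → List Bool → ℝ
  | _, [] => 1
  | s, b :: w => q s b * modelWeight step q (step s b) w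

variable {step : S → Bool → S} {q : S → Bool → ℝ}

theorem modelWeight_append (s : S) (u w : List Bool) :
    modelWeight step q s (u ++ w) =
      modelWeight step q s u * modelWeight step q (u.foldl step s) w := by
  induction u generalizing s with
  | nil => simp [modelWeight]
  | cons b u ih => simp [modelWeight, ih, mul_assoc]

theorem modelWeight_pos (hq : ∀ s b, 0 < q s b) (s : S) (w : List Bool) :
    0 < modelWeight step q s w := by
  induction w generalizing s with
  | nil => simp [modelWeight]
  | cons b w ih => exact mul_pos (hq s b) (ih _)

theorem modelWeight_const_mul (β : ℝ) (s : S) (w : List Bool) :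
    modelWeight step (fun s b => β * q s b) s w = β ^ w.length * modelWeight step q s w := by
  induction w generalizing s with
  | nil => simp [modelWeight]
  | cons b w ih =>
    simp only [modelWeight, ih, List.length_cons]
    ring

theorem sum_modelWeight_wordSet_le (hq : ∀ s b, 0 < q s b) {β : ℝ} (hβ : 0 ≤ β)
    (hsum : ∀ s, q s false + q s true ≤ β) (s : S) (n : ℕ) :
    ∑ w ∈ wordSet n, modelWeight step q s w ≤ β ^ n := by
  induction n generalizing s with
  | zero => simp [wordSet_zero, modelWeight]
  | succ n ih =>
    rw [sum_wordSet_succ]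
    simp only [modelWeight]
    rw [← Finset.mul_sum, ← Finset.mul_sum]
    have h0 := mul_le_mul_of_nonneg_left (ih (step s false)) (hq s false).le
    have h1 := mul_le_mul_of_nonneg_left (ih (step s true)) (hq s true).le
    have h2 := mul_le_mul_of_nonneg_right (hsum s) (pow_nonneg hβ n)
    rw [pow_succ]
    linarith

theorem sum_modelWeight_le (hq : ∀ s b, 0 < q s b) {β : ℝ} (hβ : 0 ≤ β) (hβ1 : β < 1)
    (hsum : ∀ s, q s false + q s true ≤ β) (s : S) (F : Finset (List Bool)) :
    ∑ w ∈ F, modelWeight step q s w ≤ 1 / (1 - β) := by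
  set L := F.sup List.length + 1
  rw [← Finset.sum_fiberwise_of_maps_to (t := Finset.range L) (g := List.length)
    fun w hw => Finset.mem_range.2 (Nat.lt_succ_of_le (Finset.le_sup (f := List.length) hw))]
  calc _ ≤ ∑ n ∈ Finset.range L, β ^ n := by
        refine Finset.sum_le_sum fun n _ => le_trans ?_
          (sum_modelWeight_wordSet_le (step := step) hq hβ hsum s n)
        refine Finset.sum_le_sum_of_subset_of_nonneg ?_ fun w _ _ => (modelWeight_pos hq s w).le
        intro w hw
        exact mem_wordSet.2 (Finset.mem_filter.1 hw).2
    _ ≤ 1 / (1 - β) := by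
        have h := (summable_geometric_of_lt_one hβ hβ1).sum_le_tsum (Finset.range L)
          fun n _ => pow_nonneg hβ n
        rwa [tsum_geometric_of_lt_one hβ hβ1, ← one_div] at h

/-- The phrases of the LZ78 parsing are distinct, except possibly for the last one. -/
theorem exists_phrases (fuel : ℕ) (rest : List Bool) (hf : rest.length ≤ fuel)
    (seen : List (List Bool)) : ∃ ph e : List (List Bool), (ph ++ e).flatten = rest ∧
      (ph ++ e).length = lzCountAux fuel rest seen ∧ e.length ≤ 1 ∧ ph.Nodup ∧
      ∀ w ∈ ph, w ∉ seen := by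
  induction fuel generalizing rest seen with
  | zero =>
    obtain rfl : rest = [] := List.length_eq_zero_iff.1 (by omega)
    exact ⟨[], [], by simp [lzCountAux_nil]⟩
  | succ fuel ih =>
    by_cases hr : rest = []
    · subst hr
      exact ⟨[], [], by simp [lzCountAux_nil]⟩
    obtain ⟨h1, h2, -⟩ := lzNext_spec hr seen
    rw [lzCountAux_succ fuel hr]
    rcases h2 with h2 | h2
    · obtain ⟨ph, e, hfl, hlen, he, hnd, hns⟩ := ih (rest.drop (lzNext rest seen + 1))
        (by rw [List.length_drop]; omega) (rest.take (lzNext rest seen + 1) :: seen)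
      refine ⟨rest.take (lzNext rest seen + 1) :: ph, e, ?_, ?_, he, ?_, ?_⟩
      · rw [List.cons_append, List.flatten_cons, hfl, List.take_append_drop]
      · rw [List.cons_append, List.length_cons, hlen, add_comm]
      · exact List.nodup_cons.2 ⟨fun h => hns _ h List.mem_cons_self, hnd⟩
      · intro w hw
        rcases List.mem_cons.1 hw with rfl | hw
        · exact h2
        · exact fun h => hns w hw (List.mem_cons_of_mem _ h)
    · refine ⟨[], [rest], ?_⟩
      rw [h2, List.drop_length, lzCountAux_nil]
      simp

/-- Total weight of a word over all initial states. -/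
noncomputable def totalWeight [Fintype S] (step : S → Bool → S) (q : S → Bool → ℝ)
    (w : List Bool) : ℝ := ∑ s, modelWeight step q s w

variable [Fintype S]

theorem sum_totalWeight_le (hq : ∀ s b, 0 < q s b) {β : ℝ} (hβ : 0 ≤ β) (hβ1 : β < 1)
    (hsum : ∀ s, q s false + q s true ≤ β) {ph : List (List Bool)} (hph : ph.Nodup) :
    (ph.map (totalWeight step q)).sum ≤ Fintype.card S / (1 - β) := by
  rw [← List.sum_toFinset _ hph]
  rw [show totalWeight step q = fun w => ∑ s, modelWeight step q s w from rfl, Finset.sum_comm]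
  refine (Finset.sum_le_sum fun s _ => sum_modelWeight_le hq hβ hβ1 hsum s _).trans ?_
  rw [Finset.sum_const, nsmul_eq_mul, Finset.card_univ, mul_one_div]

theorem totalWeight_pos [Nonempty S] (hq : ∀ s b, 0 < q s b) (w : List Bool) :
    0 < totalWeight step q w :=
  Finset.sum_pos (fun s _ => modelWeight_pos hq s w) Finset.univ_nonempty

theorem modelWeight_le_totalWeight (hq : ∀ s b, 0 < q s b) (s : S) (w : List Bool) :
    modelWeight step q s w ≤ totalWeight step q w :=
  Finset.single_le_sum (f := fun s => modelWeight step q s w)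
    (fun s _ => (modelWeight_pos hq s w).le) (Finset.mem_univ s)

/-- Comparison of `log` with its tangent at `A / m`, summed over the phrases. -/
theorem log_modelWeight_flatten_le [Nonempty S] (hq : ∀ s b, 0 < q s b) {m A : ℝ} (hm : 0 < m)
    (hA : 0 < A) (s : S) (ph : List (List Bool)) :
    Real.log (modelWeight step q s ph.flatten) ≤
      ph.length * (Real.log A - Real.log m - 1) +
        m / A * (ph.map (totalWeight step q)).sum := by
  induction ph generalizing s with
  | nil => simp [modelWeight]
  | cons w ph ih =>
    rw [List.flatten_cons, modelWeight_append,
      Real.log_mul (modelWeight_pos hq _ _).ne' (modelWeight_pos hq _ _).ne']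
    have h1 := ih (w.foldl step s)
    have h2 := Real.log_le_log (modelWeight_pos (step := step) hq s w)
      (modelWeight_le_totalWeight hq s w)
    have hp := totalWeight_pos (step := step) hq w
    have h3 := Real.log_le_sub_one_of_pos (show 0 < m * totalWeight step q w / A by positivity)
    rw [Real.log_div (by positivity) hA.ne', Real.log_mul hm.ne' hp.ne'] at h3
    rw [List.length_cons, List.map_cons, List.sum_cons]
    push_cast
    have h4 : m / A * (totalWeight step q w + (ph.map (totalWeight step q)).sum) =
        m * totalWeight step q w / A + m / A * (ph.map (totalWeight step q)).sum := by ring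
    rw [h4]
    linarith

theorem lzCount_mul_log_le [Nonempty S] (hq : ∀ s b, 0 < q s b) {β : ℝ} (hβ : 0 ≤ β) (hβ1 : β < 1)
    (hsum : ∀ s, q s false + q s true ≤ β) (s : S) (x : List Bool) :
    lzCount x * Real.log (lzCount x) ≤ -Real.log (modelWeight step q s x) +
      lzCount x * Real.log (2 * Fintype.card S / (1 - β)) := by
  obtain ⟨ph, e, hfl, hlen, he, hnd, -⟩ := exists_phrases x.length x le_rfl []
  rw [← lzCount] at hlen
  set A : ℝ := 2 * Fintype.card S / (1 - β) with hAdef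
  have hβ' : 0 < 1 - β := by linarith
  have hS : (0 : ℝ) < Fintype.card S := by exact_mod_cast Fintype.card_pos
  have hA : 0 < A := by positivity
  have hsumA : ((ph ++ e).map (totalWeight step q)).sum ≤ A := by
    have hend : e.Nodup := by
      match e, he with
      | [], _ => simp
      | [a], _ => simp
    rw [List.map_append, List.sum_append]
    have h1 := sum_totalWeight_le (step := step) hq hβ hβ1 hsum hnd
    have h2 := sum_totalWeight_le (step := step) hq hβ hβ1 hsum hend
    have h3 : A = Fintype.card S / (1 - β) + Fintype.card S / (1 - β) := by rw [hAdef]; ring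
    linarith
  rcases Nat.eq_zero_or_pos (lzCount x) with hc | hc
  · have hnil : ph ++ e = [] := List.length_eq_zero_iff.1 (hlen.trans hc)
    rw [← hfl, hnil] at hc ⊢
    simp [modelWeight, lzCount, lzCountAux]
  · have hm : (0 : ℝ) < lzCount x := by exact_mod_cast hc
    have h1 := log_modelWeight_flatten_le (step := step) hq hm hA s (ph ++ e)
    rw [hfl, hlen] at h1
    have h2 := mul_le_mul_of_nonneg_left hsumA (show 0 ≤ (lzCount x : ℝ) / A by positivity)
    rw [div_mul_cancel₀ _ hA.ne'] at h2
    linarith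

theorem lzCount_le {κ : ℝ} (hκ : 0 < κ) (x : List Bool) :
    (lzCount x : ℝ) ≤ κ * x.length + Real.exp ((1 / κ + 1) * Real.log 4) := by
  have hw : modelWeight (fun _ _ => ()) (fun _ _ => (1 / 4 : ℝ)) () x = (1 / 4) ^ x.length := by
    induction x with
    | nil => simp [modelWeight]
    | cons b x ih => rw [modelWeight, ih, List.length_cons, pow_succ, mul_comm]
  have h := lzCount_mul_log_le (step := fun _ _ => ()) (q := fun _ _ => (1 / 4 : ℝ))
    (fun _ _ => by norm_num) (β := 1 / 2) (by norm_num) (by norm_num) (fun _ => by norm_num) () x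
  rw [hw, Real.log_pow, one_div, Real.log_inv] at h
  norm_num at h
  have hexp := Real.exp_pos ((1 / κ + 1) * Real.log 4)
  by_contra! hlt
  have hn : (0 : ℝ) ≤ x.length := by positivity
  have hlt1 : κ * x.length < lzCount x := by linarith
  have hlt2 : Real.exp ((1 / κ + 1) * Real.log 4) < lzCount x := by nlinarith
  have hm : (0 : ℝ) < lzCount x := hexp.trans hlt2
  have hl := (Real.lt_log_iff_exp_lt hm).2 hlt2
  have h4 : 0 < Real.log 4 := Real.log_pos (by norm_num)
  have h5 : (x.length : ℝ) * Real.log 4 ≤ lzCount x * (1 / κ * Real.log 4) := by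
    have : (x.length : ℝ) ≤ lzCount x * (1 / κ) := by
      rw [mul_one_div, le_div_iff₀ hκ]
      linarith
    nlinarith
  nlinarith

theorem lzLen_mul_log_two_le (x : List Bool) :
    lzLen x * Real.log 2 ≤ lzCount x * Real.log (lzCount x) + lzCount x * (2 * Real.log 2) := by
  have h2 : 0 < Real.log 2 := Real.log_pos (by norm_num)
  have h : ∀ k ∈ Finset.range (lzCount x), ((Nat.clog 2 (k + 1) + 1 : ℕ) : ℝ) * Real.log 2 ≤
      Real.log (lzCount x) + 2 * Real.log 2 := by
    intro k hk
    rw [Finset.mem_range] at hk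
    have hk1 : ((k + 1 : ℕ) : ℝ) ≤ lzCount x := by exact_mod_cast hk
    have hk0 : (1 : ℝ) ≤ ((k + 1 : ℕ) : ℝ) := by exact_mod_cast Nat.succ_pos k
    have h1 := Nat.ceil_lt_add_one (Real.logb_nonneg (b := 2) (by norm_num) hk0)
    have h3 := Real.natCeil_logb_natCast 2 (k + 1)
    rw [Nat.cast_ofNat] at h3
    rw [h3, Real.logb] at h1
    have h4 := Real.log_le_log (by linarith) hk1
    have h5 : Real.log ((k + 1 : ℕ) : ℝ) / Real.log 2 * Real.log 2 = Real.log ((k + 1 : ℕ) : ℝ) :=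
      div_mul_cancel₀ _ h2.ne'
    have h6 := mul_lt_mul_of_pos_right h1 h2
    push_cast at *
    linarith
  have h3 := Finset.sum_le_sum h
  rw [Finset.sum_const, Finset.card_range, nsmul_eq_mul, ← Finset.sum_mul, ← Nat.cast_sum] at h3
  rw [lzLen]
  linarith

/-- LZ78 performs asymptotically at least as well as every finite-state model, uniformly in the
letter probabilities. -/
theorem exists_lzLen_le (S : Type*) [Fintype S] [Nonempty S] {η : ℝ} (hη : 0 < η) :
    ∃ C : ℝ, 0 ≤ C ∧ ∀ (step : S → Bool → S) (q : S → Bool → ℝ), (∀ s b, 0 < q s b) →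
      (∀ s, q s false + q s true ≤ 1) → ∀ (s : S) (x : List Bool),
      lzLen x * Real.log 2 ≤ -Real.log (modelWeight step q s x) + η * x.length + C := by
  set β := Real.exp (-(η / 2)) with hβdef
  have hβ0 : 0 < β := Real.exp_pos _
  have hβ1 : β < 1 := Real.exp_lt_one_iff.2 (by linarith)
  have hS : (1 : ℝ) ≤ Fintype.card S := by exact_mod_cast Fintype.card_pos (α := S)
  have h2 : 0 < Real.log 2 := Real.log_pos (by norm_num)
  set A : ℝ := 2 * Fintype.card S / (1 - β) with hA
  have hA1 : 1 ≤ A := by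
    rw [hA, le_div_iff₀ (by linarith)]
    linarith
  set D := Real.log A + 2 * Real.log 2 with hD
  have hD0 : 0 < D := by
    have := Real.log_nonneg hA1
    linarith
  set κ := η / (2 * D) with hκdef
  have hκ : 0 < κ := by positivity
  refine ⟨Real.exp ((1 / κ + 1) * Real.log 4) * D, by positivity, fun step q hq hsum s x => ?_⟩
  have h1 := lzCount_mul_log_le (step := step) (q := fun s b => β * q s b)
    (fun s b => mul_pos hβ0 (hq s b)) hβ0.le hβ1
    (fun s => by have := mul_le_mul_of_nonneg_left (hsum s) hβ0.le; linarith) s x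
  rw [modelWeight_const_mul, Real.log_mul (by positivity) (modelWeight_pos hq s x).ne',
    Real.log_pow, hβdef, Real.log_exp, ← hβdef, ← hA] at h1
  have h3 := lzLen_mul_log_two_le x
  have h4 := mul_le_mul_of_nonneg_right (lzCount_le hκ x) hD0.le
  have h5 : κ * x.length * D = η / 2 * x.length := by
    rw [hκdef]
    field_simp
  rw [add_mul, h5] at h4
  rw [hD] at h4 ⊢
  linarith

end FiniteStateModels

section MarkovModels

/-- Transition of the model whose state consists of the last `k` letters. -/
def markovStep {k : ℕ} (s : Fin k → Bool) (b : Bool) : Fin k → Bool :=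
  Fin.tail (Fin.snoc (α := fun _ => Bool) s b)

/-- Smoothed conditional probability under `μ` of the letter `b` after the word `s`. -/
noncomputable def markovProb (μ : Measure (ℕ → Bool)) (δ : ℝ) {k : ℕ} (s : Fin k → Bool)
    (b : Bool) : ℝ :=
  (cylProb μ (Fin.snoc (α := fun _ => Bool) s b) + δ) / (cylProb μ s + 2 * δ)

theorem snoc_window (ω : ℕ → Bool) (k p : ℕ) :
    Fin.snoc (α := fun _ => Bool) (window ω k p) (ω (p + k)) = window ω (k + 1) p :=
  Fin.snoc_init_self (window ω (k + 1) p)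

theorem markovStep_window (ω : ℕ → Bool) (k p : ℕ) :
    markovStep (window ω k p) (ω (p + k)) = window ω k (p + 1) := by
  rw [markovStep, snoc_window]
  funext i
  simp only [Fin.tail, window, Fin.val_succ]
  congr 1
  omega

theorem ofFn_window_succ (ω : ℕ → Bool) (N p : ℕ) :
    List.ofFn (window ω (N + 1) p) = ω p :: List.ofFn (window ω N (p + 1)) := by
  rw [List.ofFn_succ]
  congr 2
  funext i
  simp only [window, Fin.val_succ]
  congr 1
  omega

theorem neg_log_modelWeight_window {k : ℕ} {q : (Fin k → Bool) → Bool → ℝ}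
    (hq : ∀ s b, 0 < q s b) (ω : ℕ → Bool) (N p : ℕ) :
    -Real.log (modelWeight markovStep q (window ω k p) (List.ofFn (window ω N (p + k)))) =
      ∑ t ∈ Finset.range N, -Real.log (q (window ω k (p + t)) (ω (p + t + k))) := by
  induction N generalizing p with
  | zero => simp [modelWeight]
  | succ N ih =>
    rw [ofFn_window_succ, modelWeight, markovStep_window,
      Real.log_mul (hq _ _).ne' (modelWeight_pos hq _ _).ne', neg_add,
      show p + k + 1 = p + 1 + k by ring, ih, Finset.sum_range_succ', add_comm]
    congr 1
    refine Finset.sum_congr rfl fun t _ => ?_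
    rw [show p + 1 + t = p + (t + 1) by ring]

/-- The sequence `ω` preceded by `k` zeros. -/
def padded (ω : ℕ → Bool) (k : ℕ) : ℕ → Bool := fun p => if p < k then false else ω (p - k)

theorem window_padded (ω : ℕ → Bool) (k L p : ℕ) :
    window (padded ω k) L (p + k) = window ω L p := by
  funext i
  simp only [window, padded]
  rw [if_neg (by omega)]
  congr 1
  omega

theorem sum_snoc (k : ℕ) (f : (Fin (k + 1) → Bool) → ℝ) :
    ∑ v, f v = ∑ s : Fin k → Bool, ∑ b : Bool, f (Fin.snoc (α := fun _ => Bool) s b) := by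
  rw [← Fintype.sum_prod_type', ← (Fin.snocEquiv fun _ : Fin (k + 1) => Bool).sum_comp,
    ← (Equiv.prodComm _ _).sum_comp]
  rfl

theorem cylProb_eq_add (μ : Measure (ℕ → Bool)) [IsProbabilityMeasure μ] {k : ℕ}
    (s : Fin k → Bool) : cylProb μ s = cylProb μ (Fin.snoc (α := fun _ => Bool) s false) +
      cylProb μ (Fin.snoc (α := fun _ => Bool) s true) := by
  have h : ∀ b, List.ofFn (Fin.snoc (α := fun _ => Bool) s b) = List.ofFn s ++ [b] := by
    intro b
    rw [List.ofFn_succ']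
    simp
  simp only [cylProb]
  rw [h, h, measure_cyl_eq_add, ENNReal.toReal_add (measure_ne_top _ _) (measure_ne_top _ _)]

theorem markovProb_pos (μ : Measure (ℕ → Bool)) {δ : ℝ} (hδ : 0 < δ) {k : ℕ} (s : Fin k → Bool)
    (b : Bool) : 0 < markovProb μ δ s b := by
  have h1 := cylProb_nonneg μ s
  have h2 := cylProb_nonneg μ (Fin.snoc (α := fun _ => Bool) s b)
  exact div_pos (by linarith) (by linarith)

theorem markovProb_add (μ : Measure (ℕ → Bool)) [IsProbabilityMeasure μ] {δ : ℝ} (hδ : 0 < δ)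
    {k : ℕ} (s : Fin k → Bool) : markovProb μ δ s false + markovProb μ δ s true = 1 := by
  have h1 := cylProb_nonneg μ s
  rw [markovProb, markovProb, ← add_div, div_eq_one_iff_eq (by linarith), cylProb_eq_add μ s]
  ring

theorem markovProb_le_one (μ : Measure (ℕ → Bool)) [IsProbabilityMeasure μ] {δ : ℝ} (hδ : 0 < δ)
    {k : ℕ} (s : Fin k → Bool) (b : Bool) : markovProb μ δ s b ≤ 1 := by
  have h := markovProb_add μ hδ s
  have h0 := markovProb_pos μ hδ s false
  have h1 := markovProb_pos μ hδ s true
  cases b <;> linarith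

/-- Ideal code length of the last letter of a window given the preceding letters. -/
noncomputable def markovLoss (μ : Measure (ℕ → Bool)) (δ : ℝ) {k : ℕ} (v : Fin (k + 1) → Bool) :
    ℝ :=
  -Real.log (markovProb μ δ (Fin.init (α := fun _ => Bool) v) (v (Fin.last k)))

theorem markovLoss_nonneg (μ : Measure (ℕ → Bool)) [IsProbabilityMeasure μ] {δ : ℝ} (hδ : 0 < δ)
    {k : ℕ} (v : Fin (k + 1) → Bool) : 0 ≤ markovLoss μ δ v :=
  neg_nonneg.2 (Real.log_nonpos (markovProb_pos μ hδ _ _).le (markovProb_le_one μ hδ _ _))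

theorem tendsto_sum_markovLoss (μ : Measure (ℕ → Bool)) [IsProbabilityMeasure μ] (k : ℕ) :
    Tendsto (fun δ => ∑ v : Fin (k + 1) → Bool, cylProb μ v * markovLoss μ δ v)
      (nhdsWithin 0 (Set.Ioi 0)) (nhds (blockEntropy μ (k + 1) - blockEntropy μ k)) := by
  have hlim : blockEntropy μ (k + 1) - blockEntropy μ k = ∑ s : Fin k → Bool, ∑ b : Bool,
      cylProb μ (Fin.snoc (α := fun _ => Bool) s b) * (Real.log (cylProb μ s) -
        Real.log (cylProb μ (Fin.snoc (α := fun _ => Bool) s b))) := by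
    rw [blockEntropy, sum_snoc, blockEntropy, ← Finset.sum_sub_distrib]
    refine Finset.sum_congr rfl fun s _ => ?_
    simp only [Fintype.sum_bool, Real.negMulLog]
    have h := cylProb_eq_add μ s
    linear_combination Real.log (cylProb μ s) * h
  rw [hlim]
  simp_rw [sum_snoc]
  refine tendsto_finsetSum _ fun s _ => tendsto_finsetSum _ fun b _ => ?_
  have hle : cylProb μ (Fin.snoc (α := fun _ => Bool) s b) ≤ cylProb μ s := by
    rw [cylProb_eq_add μ s]
    have h0 := cylProb_nonneg μ (Fin.snoc (α := fun _ => Bool) s false)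
    have h1 := cylProb_nonneg μ (Fin.snoc (α := fun _ => Bool) s true)
    cases b <;> linarith
  rcases (cylProb_nonneg μ (Fin.snoc (α := fun _ => Bool) s b)).eq_or_lt with h0 | h0
  · simp [← h0]
  refine Tendsto.const_mul _ ?_
  have hs : 0 < cylProb μ s := h0.trans_le hle
  have hcont : ContinuousAt (fun δ : ℝ => Real.log (cylProb μ s + 2 * δ) -
      Real.log (cylProb μ (Fin.snoc (α := fun _ => Bool) s b) + δ)) 0 := by
    refine ContinuousAt.sub (ContinuousAt.log (by fun_prop) (by simpa using hs.ne'))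
      (ContinuousAt.log (by fun_prop) (by simpa using h0.ne'))
  have ht := hcont.tendsto.mono_left (nhdsWithin_le_nhds (s := Set.Ioi 0))
  simp only [mul_zero, add_zero] at ht
  refine ht.congr' ?_
  filter_upwards [self_mem_nhdsWithin] with δ hδ
  have hδ' : (0 : ℝ) < δ := hδ
  rw [markovLoss, Fin.init_snoc, Fin.snoc_last, markovProb,
    Real.log_div (by linarith) (by linarith)]
  ring

theorem exists_blockEntropy_sub_lt {μ : Measure (ℕ → Bool)} [IsProbabilityMeasure μ] {H : ℝ}
    (hH : HasEntropy μ H) {ε : ℝ} (hε : 0 < ε) :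
    ∃ k, blockEntropy μ (k + 1) - blockEntropy μ k < (H + ε) * Real.log 2 := by
  by_contra! hcon
  have h2 : 0 < Real.log 2 := Real.log_pos (by norm_num)
  have hge : ∀ n : ℕ, n * ((H + ε) * Real.log 2) ≤ blockEntropy μ n := by
    intro n
    induction n with
    | zero => simp [blockEntropy_zero]
    | succ n ih =>
      have := hcon n
      push_cast
      linarith
  have hle : H + ε ≤ H := by
    refine ge_of_tendsto hH ?_
    filter_upwards [eventually_gt_atTop 0] with n hn
    have h := hge n
    rw [blockEntropy_eq] at h
    have hn' : (0 : ℝ) < n := by exact_mod_cast hn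
    exact le_of_mul_le_mul_right (le_of_mul_le_mul_left h hn') h2
  linarith

/-- On a generic sequence, the block realizations of LZ78 compress to at most the entropy rate, up
to a bounded overhead per block. -/
theorem Generic.exists_sum_lzLen_le {μ : Measure (ℕ → Bool)} [IsProbabilityMeasure μ] {ω : ℕ → Bool}
    (hω : Generic μ ω) {H : ℝ} (hH : HasEntropy μ H) {ε : ℝ} (hε : 0 < ε) :
    ∃ C : ℝ, 0 ≤ C ∧ ∀ N : ℕ, 0 < N → ∀ᶠ B : ℕ in atTop,
      (∑ a ∈ Finset.range B, (lzLen (List.ofFn (window ω N (a * N))) : ℝ)) ≤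
        (H + ε) * (N * B) + C * B := by
  have h2 : 0 < Real.log 2 := Real.log_pos (by norm_num)
  obtain ⟨k, hk⟩ := exists_blockEntropy_sub_lt hH (half_pos hε)
  obtain ⟨δ, hlt, hδ⟩ := (((tendsto_sum_markovLoss μ k).eventually_lt_const hk).and
    self_mem_nhdsWithin).exists
  replace hδ : 0 < δ := hδ
  obtain ⟨C, hC0, hC⟩ := exists_lzLen_le (Fin k → Bool)
    (show 0 < ε / 4 * Real.log 2 by positivity)
  set K : ℝ := ∑ j ∈ Finset.range k, markovLoss μ δ (window (padded ω k) (k + 1) j) with hK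
  have hloss : ∀ n : ℕ, ∑ j ∈ Finset.range n, markovLoss μ δ (window (padded ω k) (k + 1) j) ≤
      K + ∑ j ∈ Finset.range n, markovLoss μ δ (window ω (k + 1) j) := by
    intro n
    refine (Finset.sum_le_sum_of_subset_of_nonneg (Finset.range_mono (Nat.le_add_left n k))
      fun _ _ _ => markovLoss_nonneg μ hδ _).trans (le_of_eq ?_)
    rw [Finset.sum_range_add, ← hK]
    congr 1
    refine Finset.sum_congr rfl fun j _ => ?_
    rw [add_comm k j, window_padded]
  have hblock : ∀ N a : ℕ, lzLen (List.ofFn (window ω N (a * N))) * Real.log 2 ≤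
      ∑ t ∈ Finset.range N, markovLoss μ δ (window (padded ω k) (k + 1) (a * N + t)) +
        (ε / 4 * Real.log 2 * N + C) := by
    intro N a
    have h := hC markovStep (markovProb μ δ) (markovProb_pos μ hδ)
      (fun s => (markovProb_add μ hδ s).le) (window (padded ω k) k (a * N))
      (List.ofFn (window ω N (a * N)))
    rw [← window_padded ω k, neg_log_modelWeight_window (markovProb_pos μ hδ), List.length_ofFn,
      add_assoc] at h
    rw [← window_padded ω k]
    exact h
  refine ⟨C / Real.log 2, by positivity, fun N hN => ?_⟩
  have hN' : (0 : ℝ) < N := by exact_mod_cast hN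
  have htop : Tendsto (fun B : ℕ => B * N) atTop atTop := tendsto_id.atTop_mul_const' hN
  have hgen := ((hω (k + 1) (markovLoss μ δ)).eventually_lt_const hlt)
  have hgap : ∀ᶠ n : ℕ in atTop, K ≤ ε / 4 * Real.log 2 * n :=
    (tendsto_natCast_atTop_atTop.const_mul_atTop
      (show 0 < ε / 4 * Real.log 2 by positivity)).eventually_ge_atTop K
  filter_upwards [htop.eventually hgen, htop.eventually hgap, eventually_gt_atTop 0] with B h1 h3 hB
  have hB' : (0 : ℝ) < B := by exact_mod_cast hB
  push_cast at h1 h3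
  rw [div_lt_iff₀ (by positivity)] at h1
  have h4 := Finset.sum_le_sum fun a (_ : a ∈ Finset.range B) => hblock N a
  rw [← Finset.sum_mul, Finset.sum_add_distrib, ← sum_range_mul
    (fun j => markovLoss μ δ (window (padded ω k) (k + 1) j)), Finset.sum_const, Finset.card_range,
    nsmul_eq_mul] at h4
  have h5 := hloss (B * N)
  refine le_of_mul_le_mul_right ?_ h2
  have h6 : ((H + ε) * (N * B) + C / Real.log 2 * B) * Real.log 2 =
      (H + ε) * (N * B) * Real.log 2 + C * B := by
    field_simp
  rw [h6]
  nlinarith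

end MarkovModels

section BlockRatio

theorem HasEntropy.nonneg {μ : Measure (ℕ → Bool)} [IsProbabilityMeasure μ] {H : ℝ}
    (hH : HasEntropy μ H) : 0 ≤ H := by
  refine ge_of_tendsto' hH fun n => ?_
  refine mul_nonneg (by positivity) (Finset.sum_nonneg fun v _ => ?_)
  rw [neg_nonneg]
  exact mul_nonpos_of_nonneg_of_nonpos ENNReal.toReal_nonneg
    (Real.logb_nonpos (by norm_num) ENNReal.toReal_nonneg
      (ENNReal.toReal_mono (by simp) prob_le_one))

theorem natCast_blockLenOf_lzLen (N : ℕ) (ω : ℕ → Bool) (n : ℕ) :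
    (blockLenOf lzLen N ω n : ℝ) =
      (∑ a ∈ Finset.range (n / N), (lzLen (List.ofFn (window ω N (a * N))) : ℝ)) +
        (n % N : ℕ) := by
  rw [blockLenOf]
  push_cast
  rfl

theorem blockRatioOf_eq_ofReal (len : List Bool → ℕ) (N : ℕ) (ω : ℕ → Bool) {n : ℕ} (hn : 0 < n) :
    blockRatioOf len N ω n = ENNReal.ofReal (blockLenOf len N ω n / n) := by
  rw [blockRatioOf, ENNReal.ofReal_div_of_pos (by exact_mod_cast hn), ENNReal.ofReal_natCast,
    ENNReal.ofReal_natCast]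

variable {μ : Measure (ℕ → Bool)} [IsProbabilityMeasure μ] {ω : ℕ → Bool} {H : ℝ}

theorem Generic.le_limsup_blockRatioOf (hω : Generic μ ω) (hH : HasEntropy μ H) {N : ℕ}
    (hN : 0 < N) : ENNReal.ofReal H ≤ limsup (fun n => blockRatioOf lzLen N ω n) atTop := by
  by_contra! hlt
  obtain ⟨d, hd1, hd2⟩ := exists_between hlt
  have hdtop : d ≠ ⊤ := hd2.ne_top
  have hev := eventually_lt_of_limsup_lt hd1
  have htop : Tendsto (fun B : ℕ => B * N) atTop atTop := tendsto_id.atTop_mul_const' hN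
  have hle : H ≤ d.toReal := by
    refine hω.entropy_le hH hN ?_
    filter_upwards [htop.eventually hev, eventually_gt_atTop 0] with B hB hB0
    have hpos : 0 < B * N := Nat.mul_pos hB0 hN
    have hpos' : (0 : ℝ) < (B * N : ℕ) := by exact_mod_cast hpos
    rw [blockRatioOf_eq_ofReal _ _ _ hpos, ENNReal.ofReal_lt_iff_lt_toReal (by positivity) hdtop,
      div_lt_iff₀ hpos', natCast_blockLenOf_lzLen, Nat.mul_div_cancel _ hN, Nat.mul_mod_left,
      Nat.cast_zero, add_zero] at hB
    push_cast at hB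
    rw [mul_comm (N : ℝ)]
    exact hB.le
  exact absurd hd2 (not_lt.2 (ENNReal.ofReal_le_of_le_toReal hle))

theorem Generic.eventually_limsup_blockRatioOf_le (hω : Generic μ ω) (hH : HasEntropy μ H) {ε : ℝ}
    (hε : 0 < ε) : ∀ᶠ N : ℕ in atTop,
      limsup (fun n => blockRatioOf lzLen N ω n) atTop ≤ ENNReal.ofReal (H + 3 * ε) := by
  obtain ⟨C, hC0, hC⟩ := hω.exists_sum_lzLen_le hH hε
  have hH0 := hH.nonneg
  have hCN : ∀ᶠ N : ℕ in atTop, C ≤ ε * N :=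
    (tendsto_natCast_atTop_atTop.const_mul_atTop hε).eventually_ge_atTop C
  filter_upwards [hCN, eventually_gt_atTop 0] with N hCN hN
  have hNn : ∀ᶠ n : ℕ in atTop, (N : ℝ) ≤ ε * n :=
    (tendsto_natCast_atTop_atTop.const_mul_atTop hε).eventually_ge_atTop _
  refine limsup_le_of_le (by isBoundedDefault) ?_
  filter_upwards [(Nat.tendsto_div_const_atTop hN.ne').eventually (hC N hN), hNn,
    eventually_gt_atTop 0] with n hn hNn hn0
  have hn' : (0 : ℝ) < n := by exact_mod_cast hn0
  rw [blockRatioOf_eq_ofReal _ _ _ hn0]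
  refine ENNReal.ofReal_le_ofReal ?_
  rw [div_le_iff₀ hn', natCast_blockLenOf_lzLen]
  have h1 : (N : ℝ) * (n / N : ℕ) ≤ n := by exact_mod_cast Nat.mul_div_le n N
  have h2 : ((n % N : ℕ) : ℝ) ≤ N := by exact_mod_cast (Nat.mod_lt n hN).le
  have h3 : (H + ε) * (N * (n / N : ℕ)) ≤ (H + ε) * n :=
    mul_le_mul_of_nonneg_left h1 (by linarith)
  have h4 : C * (n / N : ℕ) ≤ ε * N * (n / N : ℕ) :=
    mul_le_mul_of_nonneg_right hCN (Nat.cast_nonneg _)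
  have h5 := mul_le_mul_of_nonneg_left h1 hε.le
  linarith

theorem Generic.tendsto_limsup_blockRatioOf (hω : Generic μ ω) (hH : HasEntropy μ H) :
    Tendsto (fun N => limsup (fun n => blockRatioOf lzLen N ω n) atTop) atTop
      (nhds (ENNReal.ofReal H)) := by
  refine tendsto_order.2 ⟨fun a ha => ?_, fun b hb => ?_⟩
  · filter_upwards [eventually_gt_atTop 0] with N hN
    exact ha.trans_le (hω.le_limsup_blockRatioOf hH hN)
  · obtain ⟨d, hd1, hd2⟩ := exists_between hb
    have hdtop : d ≠ ⊤ := hd2.ne_top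
    have hlt := (ENNReal.ofReal_lt_iff_lt_toReal hH.nonneg hdtop).1 hd1
    filter_upwards [hω.eventually_limsup_blockRatioOf_le hH
      (show 0 < (d.toReal - H) / 3 by linarith)] with N hN
    refine (hN.trans_eq ?_).trans_lt hd2
    rw [show H + 3 * ((d.toReal - H) / 3) = d.toReal by ring, ENNReal.ofReal_toReal hdtop]

end BlockRatio

/-- For a computable stationary ergodic measure `P` with entropy `H` and every
Martin-Löf random `ω`, the block realization of the LZ78 code satisfies
`lim_{N→∞} limsup_{n→∞} ρ_{φ_N}(ω^n) = H`. -/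
theorem LZ78_block_optimal_on_random (μ : Measure (ℕ → Bool))
    (hprob : IsProbabilityMeasure μ) (hcomp : ComputableMeasure μ)
    (herg : Ergodic shift μ) (H : ℝ) (hH : HasEntropy μ H)
    (ω : ℕ → Bool) (hω : MLRandom μ ω) :
    Tendsto (fun N => Filter.limsup (fun n => blockRatioOf lzLen N ω n) atTop) atTop
      (nhds (ENNReal.ofReal H)) := by
  exact (hω.generic hcomp herg).tendsto_limsup_blockRatioOf hH
end

section
/- Let {Υ_n} be a complete sequence of gadgets on [0,1) such that for each n the gadget Υ_n is (1−ε_n)-well-distributed in Υ_{n+1}, where ε_n → 0 as n → ∞. Then the transformation T = T{Υ_n} of [0,1) determined by this sequence (defined λ-almost everywhere and preserving Lebesgue measure λ) is ergodic with respect to λ. -/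
open MeasureTheory Filter
open scoped ENNReal NNReal

/-- A column: a width `w` together with the list of left endpoints of its
intervals `L_1, …, L_h` (the `j`-th interval is `[a_j, a_j + w)`). -/
structure Column where
  w : ℝ
  base : List ℝ

namespace Column

/-- The support of a column: the union of its intervals. -/
def support (E : Column) : Set ℝ := ⋃ a ∈ E.base, Set.Ico a (a + E.w)

/-- Well-formedness of a column inside `[0,1)`: positive width, at least one
interval, intervals inside `[0,1)` and pairwise disjoint. -/
def IsWF (E : Column) : Prop :=
  0 < E.w ∧ E.base ≠ [] ∧ (∀ a ∈ E.base, 0 ≤ a ∧ a + E.w ≤ 1) ∧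
    E.base.Pairwise (fun a b => Disjoint (Set.Ico a (a + E.w)) (Set.Ico b (b + E.w)))

/-- The transformation of the column maps `L_j` linearly onto `L_{j+1}` :
`x ∈ L_j` is mapped to `x - a_j + a_{j+1}`. -/
def maps (E : Column) (x y : ℝ) : Prop :=
  ∃ j : ℕ, j + 1 < E.base.length ∧
    x ∈ Set.Ico (E.base.getD j 0) (E.base.getD j 0 + E.w) ∧
    y = x - E.base.getD j 0 + E.base.getD (j + 1) 0

/-- The (relative) subcolumn of a column between proportions `a` and `b` of
its width. -/
def slice (E : Column) (a b : ℝ) : Column :=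
  ⟨(b - a) * E.w, E.base.map (fun t => t + a * E.w)⟩

/-- Stacking a column `F` on top of a column `E` of the same width. -/
def stack (E F : Column) : Column := ⟨E.w, E.base ++ F.base⟩

end Column

/-- A gadget: a finite collection (list) of columns. -/
abbrev Gadget := List Column

namespace Gadget

/-- The width of a gadget: the sum of the widths of its columns. -/
def width (Υ : Gadget) : ℝ := (Υ.map Column.w).sum

/-- The support of a gadget. -/
def support (Υ : Gadget) : Set ℝ := ⋃ E ∈ Υ, E.support

/-- Well-formedness of a gadget: nonempty, well-formed columns with pairwise
disjoint supports. -/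
def IsWF (Υ : Gadget) : Prop :=
  Υ ≠ [] ∧ (∀ E ∈ Υ, E.IsWF) ∧ Υ.Pairwise (fun E F => Disjoint E.support F.support)

/-- The transformation associated with a gadget. -/
def maps (Υ : Gadget) (x y : ℝ) : Prop := ∃ E ∈ Υ, E.maps x y

/-- `Υ'` extends `Υ`: its support extends the support of `Υ` and its
transformation extends the transformation of `Υ`. -/
def Extends (Υ' Υ : Gadget) : Prop :=
  Υ.support ⊆ Υ'.support ∧ ∀ x y, Υ.maps x y → Υ'.maps x y

/-- The columns of a gadget paired with the total width of the preceding
columns. -/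
def withOffsets (Υ : Gadget) : List (Column × ℝ) :=
  Υ.zip ((Υ.map Column.w).scanl (· + ·) 0)

/-- Stacking a gadget `Λ` onto a gadget `Υ` of the same width: the column of
the result indexed by a pair `(E, F)` with `E ∈ Υ`, `F ∈ Λ` consists of the
slice of `E` at the relative position of `F` in `Λ`, with the slice of `F` at
the relative position of `E` in `Υ` stacked on top of it. -/
noncomputable def gStack (Υ Λ : Gadget) : Gadget :=
  (withOffsets Υ).flatMap (fun Eu =>
    (withOffsets Λ).map (fun Fv =>
      Column.stack
        (Eu.1.slice (Fv.2 / Gadget.width Υ) ((Fv.2 + Fv.1.w) / Gadget.width Υ))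
        (Fv.1.slice (Eu.2 / Gadget.width Υ) ((Eu.2 + Eu.1.w) / Gadget.width Υ))))

/-- Cutting a gadget into `m` copies of equal width. -/
noncomputable def cutCopies (Υ : Gadget) (m : ℕ) : List Gadget :=
  (List.range m).map (fun k => Υ.map (fun E => E.slice ((k : ℝ) / m) ((k + 1 : ℝ) / m)))

/-- `m`-fold independent cutting and stacking: cut `Υ` into `m` copies of
equal width and successively stack them: `Υ^{*(m)} = Υ_1 * ⋯ * Υ_m`. -/
noncomputable def ics (Υ : Gadget) (m : ℕ) : Gadget :=
  match cutCopies Υ m with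
  | [] => []
  | g :: gs => gs.foldl gStack g

end Gadget

/-- `Λ` is `(1-ε)`-well-distributed in `Υ` :
`Σ_{D∈Λ} Σ_{E∈Υ} |λ(Ê ∩ D̂) − λ(Ê)·λ(D̂)| < ε`. -/
noncomputable def WellDistributed (Λ Υ : Gadget) (ε : ℝ) : Prop :=
  (Λ.map (fun D =>
    (Υ.map (fun E =>
      |(volume (E.support ∩ D.support)).toReal -
        (volume E.support).toReal * (volume D.support).toReal|)).sum)).sum < ε

namespace Column

variable {E : Column}

lemma IsWF.nodup (hE : E.IsWF) : E.base.Nodup := by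
  refine hE.2.2.2.imp fun {a b} hab => ?_
  rintro rfl
  exact Set.disjoint_left.1 hab (Set.left_mem_Ico.2 (by linarith [hE.1]))
    (Set.left_mem_Ico.2 (by linarith [hE.1]))

lemma IsWF.pairwiseDisjoint (hE : E.IsWF) :
    Set.PairwiseDisjoint (↑E.base.toFinset : Set ℝ) fun a => Set.Ico a (a + E.w) := by
  intro a ha b hb hab
  have : Std.Symm fun a b : ℝ => Disjoint (Set.Ico a (a + E.w)) (Set.Ico b (b + E.w)) :=
    ⟨fun _ _ h => h.symm⟩
  exact hE.2.2.2.forall (by simpa using ha) (by simpa using hb) hab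

lemma support_eq_biUnion_toFinset (E : Column) :
    E.support = ⋃ a ∈ E.base.toFinset, Set.Ico a (a + E.w) := by
  simp [support]

lemma measurableSet_support (E : Column) : MeasurableSet E.support := by
  rw [support_eq_biUnion_toFinset]
  exact Finset.measurableSet_biUnion _ fun _ _ => measurableSet_Ico

lemma IsWF.support_subset (hE : E.IsWF) : E.support ⊆ Set.Ico 0 1 := by
  refine Set.iUnion₂_subset fun a ha => ?_
  exact Set.Ico_subset_Ico (hE.2.2.1 a ha).1 (hE.2.2.1 a ha).2

lemma IsWF.support_nonempty (hE : E.IsWF) : E.support.Nonempty := by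
  obtain ⟨a, ha⟩ := List.exists_mem_of_ne_nil _ hE.2.1
  exact ⟨a, Set.mem_biUnion (show a ∈ {x | x ∈ E.base} from ha)
    (Set.left_mem_Ico.2 (by linarith [hE.1]))⟩

/-- The measure of a set inside the support of a column is the sum over the levels. -/
lemma IsWF.measureReal_inter_support (hE : E.IsWF) {s : Set ℝ} (hs : MeasurableSet s) :
    volume.real (s ∩ E.support) =
      ∑ a ∈ E.base.toFinset, volume.real (s ∩ Set.Ico a (a + E.w)) := by
  rw [support_eq_biUnion_toFinset, Set.inter_iUnion₂]
  refine measureReal_biUnion_finset (fun a ha b hb hab => ?_)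
    (fun a _ => hs.inter measurableSet_Ico)
    (fun a _ => measure_ne_top_of_subset Set.inter_subset_right (by simp))
  exact (hE.pairwiseDisjoint ha hb hab).mono Set.inter_subset_right Set.inter_subset_right

/-- If the transformation of a column maps points of `s` exactly to points of `t`, then each level
meets `s` in a set of the same measure as that in which the next level meets `t`. -/
lemma isChain_measureReal {s t : Set ℝ} (h : ∀ x y, E.maps x y → (x ∈ s ↔ y ∈ t)) :
    E.base.IsChain fun a b => volume.real (t ∩ Set.Ico b (b + E.w)) =
      volume.real (s ∩ Set.Ico a (a + E.w)) := by
  refine List.isChain_iff_getElem.2 fun j hj => ?_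
  set a := E.base[j] with ha
  set b := E.base[j + 1] with hb
  have hpre : (fun x => x + (b - a)) ⁻¹' (t ∩ Set.Ico b (b + E.w)) =
      s ∩ Set.Ico a (a + E.w) := by
    ext x
    have hx : x ∈ Set.Ico a (a + E.w) → (x ∈ s ↔ x + (b - a) ∈ t) := fun hx =>
      h _ _ ⟨j, hj, by rw [List.getD_eq_getElem _ _ (by lia)]; exact hx, by
        rw [List.getD_eq_getElem _ _ (by lia), List.getD_eq_getElem _ _ hj]
        simp only [← ha, ← hb]; ring⟩
    have hI : x + (b - a) ∈ Set.Ico b (b + E.w) ↔ x ∈ Set.Ico a (a + E.w) := by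
      simp only [Set.mem_Ico]
      constructor <;> rintro ⟨h₁, h₂⟩ <;> constructor <;> linarith
    simp only [Set.mem_preimage, Set.mem_inter_iff, hI]
    exact ⟨fun hh => ⟨(hx hh.2).2 hh.1, hh.2⟩, fun hh => ⟨(hx hh.2).1 hh.1, hh.2⟩⟩
  rw [← hpre, Measure.real, Measure.real, measure_preimage_add_right]

end Column

lemma List.sum_map_le_add_sum_map_of_isChain {α : Type*} {f g : α → ℝ} {w : ℝ} (hw : 0 ≤ w)
    {l : List α} (hf : ∀ a ∈ l, f a ≤ w) (hg : ∀ a, 0 ≤ g a)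
    (h : l.IsChain fun a b => f b ≤ g a) : (l.map f).sum ≤ w + (l.map g).sum := by
  have key : ∀ (a : α) (t : List α), (a :: t).IsChain (fun a b => f b ≤ g a) →
      (t.map f).sum ≤ ((a :: t).map g).sum := by
    intro a t
    induction t generalizing a with
    | nil => simp [hg]
    | cons b t ih =>
      intro hc
      rw [List.isChain_cons_cons] at hc
      have := ih b hc.2
      rw [List.map_cons, List.map_cons, List.sum_cons, List.sum_cons]
      linarith [hc.1]
  cases l with
  | nil => simpa using hw
  | cons a t =>
    have := key a t h
    have := hf a (by simp)
    rw [List.map_cons, List.sum_cons]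
    linarith

namespace Column

variable {E : Column}

lemma IsWF.measureReal_inter_support_le (hE : E.IsWF) {s t : Set ℝ} (hs : MeasurableSet s)
    (ht : MeasurableSet t) (h : ∀ x y, E.maps x y → (x ∈ s ↔ y ∈ t)) :
    volume.real (t ∩ E.support) ≤ E.w + volume.real (s ∩ E.support) := by
  rw [hE.measureReal_inter_support hs, hE.measureReal_inter_support ht,
    List.sum_toFinset _ hE.nodup, List.sum_toFinset _ hE.nodup]
  refine List.sum_map_le_add_sum_map_of_isChain hE.1.le (fun a _ => ?_)
    (fun a => measureReal_nonneg) ((isChain_measureReal h).imp fun _ _ hab => hab.le)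
  calc volume.real (t ∩ Set.Ico a (a + E.w)) ≤ volume.real (Set.Ico a (a + E.w)) :=
        measureReal_mono Set.inter_subset_right (by simp)
    _ = E.w := by simp [Measure.real, hE.1.le]

/-- All levels of a column meet an invariant set in sets of the same measure. -/
lemma measureReal_inter_level_eq {s : Set ℝ} (h : ∀ x y, E.maps x y → (x ∈ s ↔ y ∈ s)) {a b : ℝ}
    (ha : a ∈ E.base) (hb : b ∈ E.base) :
    volume.real (s ∩ Set.Ico a (a + E.w)) = volume.real (s ∩ Set.Ico b (b + E.w)) := by
  have : IsTrans ℝ fun a b : ℝ => volume.real (s ∩ Set.Ico b (b + E.w)) =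
      volume.real (s ∩ Set.Ico a (a + E.w)) := ⟨fun _ _ _ h₁ h₂ => h₂.trans h₁⟩
  have : Std.Symm fun a b : ℝ => volume.real (s ∩ Set.Ico b (b + E.w)) =
      volume.real (s ∩ Set.Ico a (a + E.w)) := ⟨fun _ _ h₁ => h₁.symm⟩
  by_cases hab : a = b
  · rw [hab]
  · exact ((isChain_measureReal h).pairwise.forall ha hb hab).symm

/-- For an invariant set `s`, the smaller of the two parts into which `s` divides the support of a
column is controlled by the distance from the indicator of `s` to a slowly varying function. -/
lemma IsWF.min_measureReal_le (hE : E.IsWF) {s : Set ℝ} (hs : MeasurableSet s)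
    (h : ∀ x y, E.maps x y → (x ∈ s ↔ y ∈ s)) {g : ℝ → ℝ} (hg : Integrable g) {δ : ℝ}
    (hδ : ∀ x y, |x - y| < E.w → |g x - g y| ≤ δ) :
    min (volume.real (s ∩ E.support)) (volume.real (sᶜ ∩ E.support)) ≤
      (∫ x in E.support, |s.indicator 1 x - g x|) + δ * volume.real E.support := by
  have hc : ∀ x y, E.maps x y → (x ∈ sᶜ ↔ y ∈ sᶜ) := fun x y hxy => not_congr (h x y hxy)
  have hf : ∀ u : Set ℝ, volume u ≠ ⊤ → IntegrableOn (fun x => |s.indicator 1 x - g x|) u := by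
    intro u hu
    refine (Integrable.sub ?_ hg.integrableOn).abs
    exact ((integrableOn_const (C := (1 : ℝ)) hu).integrable.indicator hs)
  have level : ∀ a ∈ E.base,
      min (volume.real (s ∩ Set.Ico a (a + E.w))) (volume.real (sᶜ ∩ Set.Ico a (a + E.w))) ≤
      (∫ x in Set.Ico a (a + E.w), |s.indicator 1 x - g x|) +
        δ * volume.real (Set.Ico a (a + E.w)) := by
    intro a ha
    set L := Set.Ico a (a + E.w) with hL
    have hLt : volume L ≠ ⊤ := by simp [hL]
    have hi₁ : IntegrableOn (fun x => |s.indicator 1 x - g x| + δ) L :=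
      (hf L hLt).add (integrableOn_const hLt)
    have hsplit : ∫ x in L, (|s.indicator 1 x - g x| + δ) =
        (∫ x in L, |s.indicator 1 x - g x|) + δ * volume.real L := by
      rw [integral_add (hf L hLt) (integrableOn_const hLt), setIntegral_const, smul_eq_mul,
        mul_comm]
    rw [← hsplit, ← integral_inter_add_sdiff hs hi₁]
    have hclose : ∀ x ∈ L, |g x - g a| ≤ δ := fun x hx =>
      hδ x a (by rw [abs_lt]; constructor <;> linarith [hx.1, hx.2, hE.1])
    have h₁ : |1 - g a| * volume.real (s ∩ L) ≤
        ∫ x in L ∩ s, (|s.indicator 1 x - g x| + δ) := by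
      rw [Set.inter_comm s L, mul_comm, ← smul_eq_mul, ← setIntegral_const]
      refine setIntegral_mono_on (integrableOn_const (measure_ne_top_of_subset
        Set.inter_subset_left hLt)) (hi₁.mono_set Set.inter_subset_left)
        (measurableSet_Ico.inter hs) fun x hx => ?_
      rw [Set.indicator_of_mem hx.2, Pi.one_apply]
      linarith [hclose x hx.1, abs_sub_le 1 (g x) (g a)]
    have h₂ : |g a| * volume.real (sᶜ ∩ L) ≤
        ∫ x in L \ s, (|s.indicator 1 x - g x| + δ) := by
      rw [Set.inter_comm, ← Set.sdiff_eq, mul_comm, ← smul_eq_mul, ← setIntegral_const]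
      refine setIntegral_mono_on (integrableOn_const (measure_ne_top_of_subset
        Set.sdiff_subset hLt)) (hi₁.mono_set Set.sdiff_subset)
        (measurableSet_Ico.diff hs) fun x hx => ?_
      rw [Set.indicator_of_notMem hx.2]
      have htri := abs_sub_le 0 (g x) (g a)
      rw [zero_sub (g a), abs_neg] at htri
      linarith [hclose x hx.1]
    have h₃ : (1 : ℝ) ≤ |1 - g a| + |g a| := by
      linarith [le_abs_self (1 - g a), le_abs_self (g a)]
    set m := min (volume.real (s ∩ L)) (volume.real (sᶜ ∩ L)) with hm
    have hm₀ : 0 ≤ m := le_min measureReal_nonneg measureReal_nonneg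
    calc m ≤ (|1 - g a| + |g a|) * m := le_mul_of_one_le_left hm₀ h₃
      _ = |1 - g a| * m + |g a| * m := add_mul _ _ _
      _ ≤ |1 - g a| * volume.real (s ∩ L) + |g a| * volume.real (sᶜ ∩ L) := by
        gcongr
        · exact min_le_left _ _
        · exact min_le_right _ _
      _ ≤ _ := add_le_add h₁ h₂
  have hsum : ∑ a ∈ E.base.toFinset, ((∫ x in Set.Ico a (a + E.w), |s.indicator 1 x - g x|) +
      δ * volume.real (Set.Ico a (a + E.w))) =
      (∫ x in E.support, |s.indicator 1 x - g x|) + δ * volume.real E.support := by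
    rw [Finset.sum_add_distrib, ← Finset.mul_sum, support_eq_biUnion_toFinset,
      integral_biUnion_finset _ (fun _ _ => measurableSet_Ico) hE.pairwiseDisjoint
        (fun a _ => hf _ (by simp)), ← support_eq_biUnion_toFinset]
    have := hE.measureReal_inter_support MeasurableSet.univ
    simp only [Set.univ_inter] at this
    rw [this]
  rw [← hsum]
  obtain ⟨b, hb⟩ := List.exists_mem_of_ne_nil _ hE.2.1
  rcases le_total (volume.real (s ∩ Set.Ico b (b + E.w)))
    (volume.real (sᶜ ∩ Set.Ico b (b + E.w))) with hle | hle
  · refine (min_le_left _ _).trans ?_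
    rw [hE.measureReal_inter_support hs]
    refine Finset.sum_le_sum fun a ha => ?_
    have ha := List.mem_toFinset.1 ha
    rw [← measureReal_inter_level_eq h ha hb, ← measureReal_inter_level_eq hc ha hb] at hle
    exact (min_eq_left hle) ▸ level a ha
  · refine (min_le_right _ _).trans ?_
    rw [hE.measureReal_inter_support hs.compl]
    refine Finset.sum_le_sum fun a ha => ?_
    have ha := List.mem_toFinset.1 ha
    rw [← measureReal_inter_level_eq h ha hb, ← measureReal_inter_level_eq hc ha hb] at hle
    exact (min_eq_right hle) ▸ level a ha

end Column

namespace Gadget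

variable {Υ : Gadget}

open scoped Classical in
/-- The set of columns of a gadget. -/
noncomputable def columns (Υ : Gadget) : Finset Column := Υ.toFinset

@[simp]
lemma mem_columns {E : Column} : E ∈ Υ.columns ↔ E ∈ Υ := by simp [columns]

lemma IsWF.sum_columns (hΥ : Υ.IsWF) (f : Column → ℝ) :
    ∑ E ∈ Υ.columns, f E = (Υ.map f).sum := by
  classical
  have hnodup : Υ.Nodup := by
    refine hΥ.2.2.imp_of_mem fun {E F} hE _ hEF => ?_
    rintro rfl
    exact (hΥ.2.1 E hE).support_nonempty.ne_empty (disjoint_self.1 hEF)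
  rw [columns, ← List.sum_toFinset _ hnodup]

lemma IsWF.pairwiseDisjoint (hΥ : Υ.IsWF) :
    Set.PairwiseDisjoint (↑Υ.columns : Set Column) Column.support := by
  intro E hE F hF hEF
  have : Std.Symm fun E F : Column => Disjoint E.support F.support := ⟨fun _ _ h => h.symm⟩
  exact hΥ.2.2.forall (by simpa using hE) (by simpa using hF) hEF

lemma support_eq_biUnion_columns (Υ : Gadget) : Υ.support = ⋃ E ∈ Υ.columns, E.support := by
  simp [support]

lemma measurableSet_support (Υ : Gadget) : MeasurableSet Υ.support := by
  rw [support_eq_biUnion_columns]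
  exact Finset.measurableSet_biUnion _ fun E _ => E.measurableSet_support

lemma IsWF.support_subset (hΥ : Υ.IsWF) : Υ.support ⊆ Set.Ico 0 1 :=
  Set.iUnion₂_subset fun E hE => (hΥ.2.1 E hE).support_subset

lemma IsWF.mem_Ico_of_maps (hΥ : Υ.IsWF) {x y : ℝ} (h : Υ.maps x y) :
    x ∈ Set.Ico (0 : ℝ) 1 ∧ y ∈ Set.Ico (0 : ℝ) 1 := by
  obtain ⟨E, hE, j, hj, hx, rfl⟩ := h
  have hwf := (hΥ.2.1 E hE).2.2.1
  rw [List.getD_eq_getElem _ _ (by lia)] at hx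
  rw [List.getD_eq_getElem _ _ (by lia), List.getD_eq_getElem _ _ hj]
  obtain ⟨h₁, h₂⟩ := hwf _ (List.getElem_mem (show j < E.base.length by lia))
  obtain ⟨h₃, h₄⟩ := hwf _ (List.getElem_mem hj)
  obtain ⟨h₅, h₆⟩ := hx
  exact ⟨⟨by linarith, by linarith⟩, ⟨by linarith, by linarith⟩⟩

lemma IsWF.measureReal_inter_biUnion (hΥ : Υ.IsWF) {F : Finset Column} (hF : F ⊆ Υ.columns)
    {s : Set ℝ} (hs : MeasurableSet s) :
    volume.real (s ∩ ⋃ E ∈ F, E.support) = ∑ E ∈ F, volume.real (s ∩ E.support) := by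
  rw [Set.inter_iUnion₂]
  refine measureReal_biUnion_finset (fun E hE E' hE' hne => ?_)
    (fun E _ => hs.inter E.measurableSet_support)
    (fun E hE => measure_ne_top_of_subset (Set.inter_subset_right.trans
      (hΥ.2.1 E (mem_columns.1 (hF hE))).support_subset) (by simp))
  exact (hΥ.pairwiseDisjoint (hF hE) (hF hE') hne).mono Set.inter_subset_right
    Set.inter_subset_right

lemma IsWF.measureReal_inter_support (hΥ : Υ.IsWF) {s : Set ℝ} (hs : MeasurableSet s) :
    volume.real (s ∩ Υ.support) = ∑ E ∈ Υ.columns, volume.real (s ∩ E.support) := by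
  rw [support_eq_biUnion_columns, hΥ.measureReal_inter_biUnion subset_rfl hs]

lemma IsWF.w_le_width (hΥ : Υ.IsWF) {E : Column} (hE : E ∈ Υ) : E.w ≤ Υ.width := by
  rw [width, ← hΥ.sum_columns]
  exact Finset.single_le_sum (f := Column.w)
    (fun F hF => (hΥ.2.1 F (mem_columns.1 hF)).1.le) (mem_columns.2 hE)

lemma IsWF.measureReal_inter_support_le (hΥ : Υ.IsWF) {s t : Set ℝ} (hs : MeasurableSet s)
    (ht : MeasurableSet t) (h : ∀ x y, Υ.maps x y → (x ∈ s ↔ y ∈ t)) :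
    volume.real (t ∩ Υ.support) ≤ Υ.width + volume.real (s ∩ Υ.support) := by
  rw [hΥ.measureReal_inter_support hs, hΥ.measureReal_inter_support ht, width,
    ← hΥ.sum_columns, ← Finset.sum_add_distrib]
  refine Finset.sum_le_sum fun E hE => ?_
  have hE := mem_columns.1 hE
  exact (hΥ.2.1 E hE).measureReal_inter_support_le hs ht fun x y hxy => h x y ⟨E, hE, hxy⟩

/-- The measure of a subset of `[0,1)` exceeds that of its part in the support of a gadget by at
most the measure of the complement of the support. -/
lemma IsWF.measureReal_le_inter_support_add (hΥ : Υ.IsWF) {s : Set ℝ} (hs : s ⊆ Set.Ico 0 1) :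
    volume.real s ≤ volume.real (s ∩ Υ.support) + (1 - volume.real Υ.support) := by
  have h₁ : volume.real (Set.Ico (0 : ℝ) 1 \ Υ.support) = 1 - volume.real Υ.support := by
    rw [measureReal_sdiff hΥ.support_subset Υ.measurableSet_support (by simp)]
    simp
  rw [← h₁, ← measureReal_inter_add_sdiff Υ.measurableSet_support
    (measure_ne_top_of_subset hs (by simp))]
  refine add_le_add_right (measureReal_mono (Set.sdiff_subset_sdiff_left hs) ?_) _
  exact measure_ne_top_of_subset Set.sdiff_subset (by simp)

/-- The columns of `Υ` at least half of whose support lies in `s`. -/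
noncomputable def majority (Υ : Gadget) (s : Set ℝ) : Finset Column :=
  open scoped Classical in
  Υ.columns.filter fun E => volume.real (sᶜ ∩ E.support) ≤ volume.real (s ∩ E.support)

/-- The union of the supports of the columns at least half of whose support lies in `s`. -/
def majoritySupport (Υ : Gadget) (s : Set ℝ) : Set ℝ := ⋃ E ∈ Υ.majority s, E.support

lemma majority_subset (Υ : Gadget) (s : Set ℝ) : Υ.majority s ⊆ Υ.columns :=
  Finset.filter_subset _ _

lemma measurableSet_majoritySupport (Υ : Gadget) (s : Set ℝ) :
    MeasurableSet (Υ.majoritySupport s) :=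
  Finset.measurableSet_biUnion _ fun E _ => E.measurableSet_support

lemma IsWF.majoritySupport_subset (hΥ : Υ.IsWF) (s : Set ℝ) :
    Υ.majoritySupport s ⊆ Set.Ico 0 1 :=
  Set.iUnion₂_subset fun E hE =>
    (hΥ.2.1 E (mem_columns.1 (Υ.majority_subset s hE))).support_subset

/-- The symmetric difference of `s` and its majority approximation meets each column in the
smaller of the two parts into which `s` divides it. -/
lemma IsWF.measureReal_symmDiff_majoritySupport_inter (hΥ : Υ.IsWF) {s : Set ℝ}
    (hs : MeasurableSet s) :
    volume.real (symmDiff s (Υ.majoritySupport s) ∩ Υ.support) =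
      ∑ E ∈ Υ.columns, min (volume.real (s ∩ E.support)) (volume.real (sᶜ ∩ E.support)) := by
  rw [hΥ.measureReal_inter_support (hs.symmDiff (Υ.measurableSet_majoritySupport s))]
  refine Finset.sum_congr rfl fun E hE => ?_
  by_cases hm : E ∈ Υ.majority s
  · have hle := (Finset.mem_filter.1 hm).2
    rw [min_eq_right hle]
    congr 1
    ext x
    have : x ∈ E.support → x ∈ Υ.majoritySupport s := fun hx => Set.mem_biUnion hm hx
    simp only [Set.mem_inter_iff, Set.mem_symmDiff, Set.mem_compl_iff]
    tauto
  · have hle : ¬ _ := fun h => hm (Finset.mem_filter.2 ⟨hE, h⟩)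
    rw [min_eq_left (not_le.1 hle).le]
    congr 1
    ext x
    have : x ∈ E.support → x ∉ Υ.majoritySupport s := by
      intro hx hx'
      obtain ⟨F, hF, hxF⟩ := Set.mem_iUnion₂.1 hx'
      have hne : E ≠ F := fun h => hm (h ▸ hF)
      exact Set.disjoint_left.1 (hΥ.pairwiseDisjoint hE (Υ.majority_subset s hF) hne) hx hxF
    simp only [Set.mem_inter_iff, Set.mem_symmDiff]
    tauto

lemma IsWF.measureReal_symmDiff_majoritySupport_le (hΥ : Υ.IsWF) {s : Set ℝ}
    (hs : MeasurableSet s) (hsI : s ⊆ Set.Ico 0 1) (h : ∀ x y, Υ.maps x y → (x ∈ s ↔ y ∈ s))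
    {g : ℝ → ℝ} (hg : Integrable g) {δ : ℝ} (hδ₀ : 0 ≤ δ)
    (hδ : ∀ x y, |x - y| < Υ.width → |g x - g y| ≤ δ) :
    volume.real (symmDiff s (Υ.majoritySupport s)) ≤
      (∫ x, |s.indicator 1 x - g x|) + δ + (1 - volume.real Υ.support) := by
  have hsub : symmDiff s (Υ.majoritySupport s) ⊆ Set.Ico 0 1 :=
    Set.symmDiff_subset_union.trans (Set.union_subset hsI (hΥ.majoritySupport_subset s))
  refine (hΥ.measureReal_le_inter_support_add hsub).trans ?_
  gcongr
  rw [hΥ.measureReal_symmDiff_majoritySupport_inter hs]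
  have hf : Integrable fun x => |s.indicator 1 x - g x| := by
    refine (Integrable.sub ?_ hg).abs
    exact (integrableOn_const (C := (1 : ℝ))
      (measure_ne_top_of_subset hsI (by simp))).integrable_indicator hs
  have hsupp : ∑ E ∈ Υ.columns, volume.real E.support = volume.real Υ.support := by
    simpa using (hΥ.measureReal_inter_support MeasurableSet.univ).symm
  calc ∑ E ∈ Υ.columns, min (volume.real (s ∩ E.support)) (volume.real (sᶜ ∩ E.support))
      ≤ ∑ E ∈ Υ.columns, ((∫ x in E.support, |s.indicator 1 x - g x|) +
          δ * volume.real E.support) := by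
        refine Finset.sum_le_sum fun E hE => ?_
        have hE := mem_columns.1 hE
        exact (hΥ.2.1 E hE).min_measureReal_le hs (fun x y hxy => h x y ⟨E, hE, hxy⟩) hg
          fun x y hxy => hδ x y (hxy.trans_le (hΥ.w_le_width hE))
    _ = (∫ x in Υ.support, |s.indicator 1 x - g x|) + δ * volume.real Υ.support := by
        rw [Finset.sum_add_distrib, ← Finset.mul_sum, hsupp, support_eq_biUnion_columns,
          integral_biUnion_finset _ (fun E _ => E.measurableSet_support) hΥ.pairwiseDisjoint
            (fun E _ => hf.integrableOn)]
    _ ≤ (∫ x, |s.indicator 1 x - g x|) + δ := by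
        refine add_le_add ?_ ?_
        · exact setIntegral_le_integral hf (Eventually.of_forall fun x => abs_nonneg _)
        · refine mul_le_of_le_one_right hδ₀ ?_
          calc volume.real Υ.support ≤ volume.real (Set.Ico (0 : ℝ) 1) :=
                measureReal_mono hΥ.support_subset (by simp)
            _ = 1 := by simp

end Gadget

/-- Well-distribution of columns passes to unions of columns. -/
lemma WellDistributed.abs_measureReal_sub_lt {Λ Υ : Gadget} {ε : ℝ} (hw : WellDistributed Λ Υ ε)
    (hΛ : Λ.IsWF) (hΥ : Υ.IsWF) (s : Set ℝ) :
    |volume.real (Υ.majoritySupport s ∩ Λ.majoritySupport s) -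
      volume.real (Υ.majoritySupport s) * volume.real (Λ.majoritySupport s)| < ε := by
  have hsum : ∀ {Θ : Gadget}, Θ.IsWF →
      volume.real (Θ.majoritySupport s) = ∑ E ∈ Θ.majority s, volume.real E.support := by
    intro Θ hΘ
    simpa [Gadget.majoritySupport] using
      hΘ.measureReal_inter_biUnion (Θ.majority_subset s) MeasurableSet.univ
  have hinter : volume.real (Υ.majoritySupport s ∩ Λ.majoritySupport s) =
      ∑ D ∈ Λ.majority s, ∑ E ∈ Υ.majority s, volume.real (E.support ∩ D.support) := by
    rw [Gadget.majoritySupport.eq_def Λ, hΛ.measureReal_inter_biUnion (Λ.majority_subset s)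
      (Υ.measurableSet_majoritySupport s)]
    refine Finset.sum_congr rfl fun D _ => ?_
    rw [Set.inter_comm, Gadget.majoritySupport, hΥ.measureReal_inter_biUnion
      (Υ.majority_subset s) D.measurableSet_support]
    simp_rw [Set.inter_comm D.support]
  rw [hinter, hsum hΛ, hsum hΥ, mul_comm, Finset.sum_mul_sum, ← Finset.sum_sub_distrib]
  simp_rw [← Finset.sum_sub_distrib]
  unfold WellDistributed at hw
  simp_rw [← hΥ.sum_columns, ← hΛ.sum_columns] at hw
  refine lt_of_le_of_lt ?_ hw
  refine (Finset.abs_sum_le_sum_abs _ _).trans ?_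
  refine (Finset.sum_le_sum fun D _ => Finset.abs_sum_le_sum_abs _ _).trans ?_
  refine (Finset.sum_le_sum fun D _ => Finset.sum_le_sum_of_subset_of_nonneg
    (Υ.majority_subset s) fun _ _ _ => abs_nonneg _).trans ?_
  refine (Finset.sum_le_sum_of_subset_of_nonneg (Λ.majority_subset s)
    fun _ _ _ => Finset.sum_nonneg fun _ _ => abs_nonneg _).trans (le_of_eq ?_)
  refine Finset.sum_congr rfl fun D _ => Finset.sum_congr rfl fun E _ => ?_
  simp only [Measure.real]
  ring_nf

/-- If the transformations of gadgets with vanishing widths fix a set, then the set is approximated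
by unions of supports of columns. -/
lemma tendsto_measureReal_symmDiff_majoritySupport {Υ : ℕ → Gadget} (hwf : ∀ n, (Υ n).IsWF)
    (hwidth : Tendsto (fun n => (Υ n).width) atTop (nhds 0))
    (hsupp : Tendsto (fun n => volume.real (Υ n).support) atTop (nhds 1))
    {s : Set ℝ} (hs : MeasurableSet s) (hsI : s ⊆ Set.Ico 0 1)
    (h : ∀ n x y, (Υ n).maps x y → (x ∈ s ↔ y ∈ s)) :
    Tendsto (fun n => volume.real (symmDiff s ((Υ n).majoritySupport s))) atTop (nhds 0) := by
  refine tendsto_order.2 ⟨fun a ha => Eventually.of_forall fun n => ha.trans_le measureReal_nonneg,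
    fun δ hδ => ?_⟩
  have hint : Integrable (s.indicator (1 : ℝ → ℝ)) :=
    (integrableOn_const (C := (1 : ℝ))
      (measure_ne_top_of_subset hsI (by simp))).integrable_indicator hs
  obtain ⟨g, hgc, hgs, hg, hgi⟩ :=
    hint.exists_hasCompactSupport_integral_sub_le (ε := δ / 4) (by positivity)
  obtain ⟨η, hη, hgη⟩ := Metric.uniformContinuous_iff.1
    (hgc.uniformContinuous_of_continuous hg) (δ / 4) (by positivity)
  filter_upwards [hwidth.eventually_lt_const hη,
    hsupp.eventually_const_lt (show 1 - δ / 4 < 1 by linarith)] with n hn hn'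
  have := (hwf n).measureReal_symmDiff_majoritySupport_le hs hsI (h n) hgi (δ := δ / 4)
    (by positivity) fun x y hxy => (hgη (hxy.trans hn)).le
  simp only [Real.norm_eq_abs] at hgs
  linarith

lemma measurePreserving_of_gadgets {Υ : ℕ → Gadget} (hwf : ∀ n, (Υ n).IsWF)
    (hwidth : Tendsto (fun n => (Υ n).width) atTop (nhds 0))
    (hsupp : Tendsto (fun n => volume.real (Υ n).support) atTop (nhds 1))
    {T : ℝ → ℝ} (hT : Measurable T) (hagree : ∀ n x y, (Υ n).maps x y → T x = y) :
    MeasurePreserving T (volume.restrict (Set.Ico (0 : ℝ) 1))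
      (volume.restrict (Set.Ico (0 : ℝ) 1)) := by
  have : IsProbabilityMeasure (volume.restrict (Set.Ico (0 : ℝ) 1)) := ⟨by simp⟩
  set μ := volume.restrict (Set.Ico (0 : ℝ) 1) with hμ
  have hle : ∀ t, MeasurableSet t → μ.real t ≤ μ.real (T ⁻¹' t) := by
    intro t ht
    have hlim : Tendsto (fun n => (Υ n).width + μ.real (T ⁻¹' t) +
        (1 - volume.real (Υ n).support)) atTop (nhds (0 + μ.real (T ⁻¹' t) + (1 - 1))) :=
      (hwidth.add_const _).add (hsupp.const_sub 1)
    rw [zero_add, sub_self, add_zero] at hlim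
    refine ge_of_tendsto' hlim fun n => ?_
    have h₁ := (hwf n).measureReal_le_inter_support_add
      (s := t ∩ Set.Ico 0 1) Set.inter_subset_right
    have h₂ := (hwf n).measureReal_inter_support_le (hT ht) ht fun x y hxy => by
      rw [Set.mem_preimage, hagree n x y hxy]
    have h₃ : volume.real (T ⁻¹' t ∩ (Υ n).support) ≤ volume.real (T ⁻¹' t ∩ Set.Ico 0 1) :=
      measureReal_mono (Set.inter_subset_inter_right _ (hwf n).support_subset)
        (measure_ne_top_of_subset Set.inter_subset_right (by simp))
    rw [Set.inter_assoc, Set.inter_eq_right.2 (hwf n).support_subset] at h₁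
    rw [hμ, measureReal_restrict_apply ht, measureReal_restrict_apply (hT ht)]
    linarith
  refine ⟨hT, Measure.ext fun t ht => ?_⟩
  rw [Measure.map_apply hT ht, ← measureReal_eq_measureReal_iff]
  refine le_antisymm ?_ (hle t ht)
  have := hle tᶜ ht.compl
  rw [Set.preimage_compl, probReal_compl_eq_one_sub ht, probReal_compl_eq_one_sub (hT ht)] at this
  linarith

lemma abs_measureReal_inter_sub_le {s B C : Set ℝ} (hs : MeasurableSet s) (hB : MeasurableSet B)
    (hC : MeasurableSet C) (hs' : volume s ≠ ⊤) (hB' : volume B ≠ ⊤) (hC' : volume C ≠ ⊤) :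
    |volume.real s - volume.real (B ∩ C)| ≤
      volume.real (symmDiff s B) + volume.real (symmDiff s C) := by
  refine (abs_measureReal_sub_le_measureReal_symmDiff' hs.nullMeasurableSet
    (hB.inter hC).nullMeasurableSet hs' (measure_ne_top_of_subset Set.inter_subset_left hB')).trans
    ((measureReal_mono ?_ ?_).trans (measureReal_union_le _ _))
  · intro x
    simp only [Set.mem_symmDiff, Set.mem_inter_iff, Set.mem_union]
    tauto
  · refine measure_ne_top_of_subset (s := s ∪ B ∪ (s ∪ C)) (Set.union_subset_union
      Set.symmDiff_subset_union Set.symmDiff_subset_union) ?_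
    finiteness

/-- A complete sequence of gadgets, each `(1-ε_n)`-well-distributed in the
next with `ε_n → 0`, determines an ergodic transformation of `[0,1)` (with
respect to Lebesgue measure). -/
theorem ergodic_of_well_distributed (Υ : ℕ → Gadget) (hwf : ∀ n, (Υ n).IsWF)
    (hext : ∀ n, (Υ (n + 1)).Extends (Υ n))
    (hwidth : Tendsto (fun n => (Υ n).width) atTop (nhds 0))
    (hsupp : Tendsto (fun n => (volume ((Υ n).support)).toReal) atTop (nhds 1))
    (ε : ℕ → ℝ) (hε : Tendsto ε atTop (nhds 0))
    (hwd : ∀ n, WellDistributed (Υ n) (Υ (n + 1)) (ε n))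
    (T : ℝ → ℝ) (hTmeas : Measurable T)
    (hagree : ∀ n x y, (Υ n).maps x y → T x = y) :
    Ergodic T (volume.restrict (Set.Ico (0 : ℝ) 1)) := by
  have hsupp' : Tendsto (fun n => volume.real (Υ n).support) atTop (nhds 1) := hsupp
  refine ⟨measurePreserving_of_gadgets hwf hwidth hsupp' hTmeas hagree, ⟨fun s hs hsT => ?_⟩⟩
  have : IsProbabilityMeasure (volume.restrict (Set.Ico (0 : ℝ) 1)) := ⟨by simp⟩
  set A := s ∩ Set.Ico (0 : ℝ) 1 with hA
  have hAm : MeasurableSet A := hs.inter measurableSet_Ico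
  have hAI : A ⊆ Set.Ico 0 1 := Set.inter_subset_right
  have hAinv : ∀ n x y, (Υ n).maps x y → (x ∈ A ↔ y ∈ A) := by
    intro n x y hxy
    have hmem := (hwf n).mem_Ico_of_maps hxy
    have : x ∈ s ↔ y ∈ s := by
      rw [← hagree n x y hxy, ← Set.mem_preimage, hsT]
    simp [hA, this, hmem.1, hmem.2]
  have hdiff := tendsto_measureReal_symmDiff_majoritySupport hwf hwidth hsupp' hAm hAI hAinv
  have hBm := fun n => (Υ n).measurableSet_majoritySupport A
  have hBtop : ∀ n, volume ((Υ n).majoritySupport A) ≠ ⊤ := fun n =>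
    measure_ne_top_of_subset ((hwf n).majoritySupport_subset A) (by simp)
  have hAtop : volume A ≠ ⊤ := measure_ne_top_of_subset hAI (by simp)
  have hB : Tendsto (fun n => volume.real ((Υ n).majoritySupport A)) atTop
      (nhds (volume.real A)) := by
    refine tendsto_iff_dist_tendsto_zero.2 (squeeze_zero (fun _ => dist_nonneg) (fun n => ?_) hdiff)
    rw [dist_comm, Real.dist_eq]
    exact abs_measureReal_sub_le_measureReal_symmDiff' hAm.nullMeasurableSet
      (hBm n).nullMeasurableSet hAtop (hBtop n)
  have hB₁ := hB.comp (tendsto_add_atTop_nat 1)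
  have hdiff₁ := hdiff.comp (tendsto_add_atTop_nat 1)
  have hBB : Tendsto (fun n => volume.real ((Υ (n + 1)).majoritySupport A ∩
      (Υ n).majoritySupport A)) atTop (nhds (volume.real A)) := by
    refine tendsto_iff_dist_tendsto_zero.2 (squeeze_zero (fun _ => dist_nonneg) (fun n => ?_)
      (by simpa using hdiff₁.add hdiff))
    rw [dist_comm, Real.dist_eq]
    exact abs_measureReal_inter_sub_le hAm (hBm _) (hBm _) hAtop (hBtop _) (hBtop _)
  have hsq : volume.real A - volume.real A * volume.real A = 0 := by
    refine tendsto_nhds_unique (hBB.sub (hB₁.mul hB)) ?_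
    exact squeeze_zero_norm (fun n =>
      ((hwd n).abs_measureReal_sub_lt (hwf n) (hwf (n + 1)) A).le) hε
  have h01 : volume.real A = 0 ∨ volume.real A = 1 := by
    have : volume.real A * (1 - volume.real A) = 0 := by linarith
    rcases mul_eq_zero.1 this with h | h
    · exact Or.inl h
    · exact Or.inr (by linarith)
  rw [hA, ← measureReal_restrict_apply hs] at h01
  rw [eventuallyConst_set']
  refine h01.imp (fun h => ?_) (fun h => ?_)
  · rwa [ae_eq_empty, ← measureReal_eq_zero_iff]
  · rw [ae_eq_univ, ← measureReal_eq_zero_iff, probReal_compl_eq_one_sub hs, h, sub_self]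
end
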